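/- arXiv:2312.15689 — 4 statements merged into one kernel-verified Lean document; each statement's English description precedes it below -/
import Mathlib

section
/- Let N ≥ 1 be an integer and let u ∈ L^1_0(ℝ^N). Then the Poisson-type extension w_u is well defined and smooth on the upper half-space ℝ^N × (0,∞), and it is a classical solution of the degenerate equation div(t ∇w_u) = 0 there, i.e. t Δ_x w_u(x,t) + t ∂_t² w_u(x,t) + ∂_t w_u(x,t) = 0 for every (x,t) ∈ ℝ^N × (0,∞). -/
open MeasureTheory Real Filter Topology Set Metric

noncomputable section

/-- The normalization constant `c_N = Γ(N/2)/π^(N/2)`. -/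
def cN (N : ℕ) : ℝ := Real.Gamma ((N : ℝ) / 2) / Real.pi ^ ((N : ℝ) / 2)

/-- Membership in the space `L^1_0(ℝ^N)`. -/
def MemL10 (N : ℕ) (u : EuclideanSpace ℝ (Fin N) → ℝ) : Prop :=
  MeasureTheory.LocallyIntegrable u volume ∧
    MeasureTheory.Integrable (fun x => (1 + ‖x‖) ^ (-(N : ℝ)) * |u x|) volume

/-- The Poisson-type extension `w_u`. -/
def poissonExt (N : ℕ) (u : EuclideanSpace ℝ (Fin N) → ℝ)
    (x : EuclideanSpace ℝ (Fin N)) (t : ℝ) : ℝ :=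
  (cN N / 2) * ∫ y, u y * (‖x - y‖ ^ 2 + t ^ 2) ^ (-(N : ℝ) / 2)

section ParametricIntegral

universe w

variable {Y Q : Type*} [TopologicalSpace Y] [MeasurableSpace Y] [OpensMeasurableSpace Y]
  [SecondCountableTopology Y] [NormedAddCommGroup Q] {μ : Measure Y}
  {v : Y → ℝ} {a : Y → Q} {K : Set Q}

/-- Integrating a function that is continuous on a compact set `K` along a continuous map into `K`
against an integrable weight. -/
lemma integrable_smul_comp_of_isCompact {G : Type*} [NormedAddCommGroup G] [NormedSpace ℝ G]
    (hv : Integrable v μ) (ha : Continuous a) (hK : IsCompact K) (haK : ∀ y, a y ∈ K)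
    {f : Q → G} (hf : ContinuousOn f K) : Integrable (fun y => v y • f (a y)) μ := by
  obtain ⟨C, hC⟩ := hK.exists_bound_of_continuousOn hf
  have hc : Continuous fun y => f (a y) := hf.comp_continuous ha haK
  refine Integrable.mono' (hv.norm.mul_const C) (hv.aestronglyMeasurable.smul hc.aestronglyMeasurable) ?_
  filter_upwards with y
  rw [norm_smul]
  gcongr
  exact hC _ (haK y)

/-- Differentiation under the integral sign for a kernel depending on the integration variable
only through a map into a compact set. -/
lemma hasFDerivAt_integral_smul_of_isCompact {E G : Type*} [NormedAddCommGroup E]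
    [NormedSpace ℝ E] [NormedAddCommGroup G] [NormedSpace ℝ G]
    (hv : Integrable v μ) (ha : Continuous a) (hK : IsCompact K) (haK : ∀ y, a y ∈ K)
    {W : Set (E × Q)} (hW : IsOpen W) {H : E × Q → G} {H' : E × Q → E →L[ℝ] G}
    (hH : ContinuousOn H W) (hH' : ContinuousOn H' W)
    (hd : ∀ z ∈ W, HasFDerivAt (fun p => H (p, z.2)) (H' z) z.1)
    {p₀ : E} (hp₀ : ∀ q ∈ K, (p₀, q) ∈ W) :
    HasFDerivAt (fun p => ∫ y, v y • H (p, a y) ∂μ) (∫ y, v y • H' (p₀, a y) ∂μ) p₀ := by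
  have slice : ∀ p, (∀ q ∈ K, (p, q) ∈ W) → ContinuousOn (fun q => H (p, q)) K :=
    fun p hp => hH.comp (by fun_prop) hp
  have slice' : ContinuousOn (fun q => H' (p₀, q)) K := hH'.comp (by fun_prop) hp₀
  obtain ⟨C, hC⟩ := hK.exists_bound_of_continuousOn slice'
  have hev : ∀ᶠ p in 𝓝 p₀, ∀ q ∈ K, (p, q) ∈ W ∧ ‖H' (p, q)‖ < C + 1 := by
    refine hK.eventually_forall_of_forall_eventually fun q hq => ?_
    have hmem := hW.mem_nhds (hp₀ q hq)
    refine (Filter.eventually_of_mem hmem fun _ h => h).and ?_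
    have hn : ContinuousAt (fun z => ‖H' z‖) (p₀, q) := (hH'.continuousAt hmem).norm
    exact hn.eventually_lt continuousAt_const (lt_of_le_of_lt (hC q hq) (by linarith))
  refine hasFDerivAt_integral_of_dominated_of_fderiv_le (𝕜 := ℝ)
    (F := fun p y => v y • H (p, a y)) (F' := fun p y => v y • H' (p, a y))
    (bound := fun y => ‖v y‖ * (C + 1)) hev ?_ ?_ ?_ ?_ (hv.norm.mul_const _) ?_
  · filter_upwards [hev] with p hp
    exact (integrable_smul_comp_of_isCompact hv ha hK haK
      (slice p fun q hq => (hp q hq).1)).aestronglyMeasurable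
  · exact integrable_smul_comp_of_isCompact hv ha hK haK (slice p₀ hp₀)
  · exact (integrable_smul_comp_of_isCompact hv ha hK haK slice').aestronglyMeasurable
  · filter_upwards with y p hp
    rw [norm_smul]
    gcongr
    exact (hp _ (haK y)).2.le
  · filter_upwards with y p hp
    exact (hd (p, a y) (hp _ (haK y)).1).const_smul (v y)

lemma hasDerivAt_integral_mul_of_isCompact
    (hv : Integrable v μ) (ha : Continuous a) (hK : IsCompact K) (haK : ∀ y, a y ∈ K)
    {W : Set (ℝ × Q)} (hW : IsOpen W) {H H' : ℝ × Q → ℝ}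
    (hH : ContinuousOn H W) (hH' : ContinuousOn H' W)
    (hd : ∀ z ∈ W, HasDerivAt (fun p => H (p, z.2)) (H' z) z.1)
    {p₀ : ℝ} (hp₀ : ∀ q ∈ K, (p₀, q) ∈ W) :
    HasDerivAt (fun p => ∫ y, v y * H (p, a y) ∂μ) (∫ y, v y * H' (p₀, a y) ∂μ) p₀ := by
  have h := hasFDerivAt_integral_smul_of_isCompact (μ := μ) hv ha hK haK hW (H := H)
    (H' := fun z => ContinuousLinearMap.toSpanSingleton ℝ (H' z)) hH
    ((ContinuousLinearMap.toSpanSingletonCLE (𝕜 := ℝ) (E := ℝ)).continuous.comp_continuousOn hH')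
    (fun z hz => (hd z hz).hasFDerivAt) hp₀
  have hi : Integrable (fun y => v y • ContinuousLinearMap.toSpanSingleton ℝ (H' (p₀, a y))) μ :=
    integrable_smul_comp_of_isCompact hv ha hK haK
      (f := fun q => ContinuousLinearMap.toSpanSingleton ℝ (H' (p₀, q)))
      ((ContinuousLinearMap.toSpanSingletonCLE (𝕜 := ℝ) (E := ℝ)).continuous.comp_continuousOn
        (hH'.comp (by fun_prop) hp₀))
  have h2 := h.hasDerivAt
  rw [ContinuousLinearMap.integral_apply hi] at h2
  simpa using h2

lemma contDiffOn_nat_integral_smul_of_isCompact {E : Type w} [NormedAddCommGroup E]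
    [NormedSpace ℝ E] [NormedSpace ℝ Q]
    (hv : Integrable v μ) (ha : Continuous a) (hK : IsCompact K) (haK : ∀ y, a y ∈ K)
    {W : Set (E × Q)} (hW : IsOpen W) {U : Set E} (hU : IsOpen U)
    (hUW : ∀ p ∈ U, ∀ q ∈ K, (p, q) ∈ W) (n : ℕ) :
    ∀ {G : Type w} [NormedAddCommGroup G] [NormedSpace ℝ G] {H : E × Q → G},
      ContDiffOn ℝ (⊤ : ℕ∞) H W → ContDiffOn ℝ n (fun p => ∫ y, v y • H (p, a y) ∂μ) U := by
  have key : ∀ {G : Type w} [NormedAddCommGroup G] [NormedSpace ℝ G] {H : E × Q → G},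
      ContDiffOn ℝ (⊤ : ℕ∞) H W →
      ContDiffOn ℝ (⊤ : ℕ∞) (fun z => (fderiv ℝ H z).comp (ContinuousLinearMap.inl ℝ E Q)) W ∧
      ∀ p ∈ U, HasFDerivAt (fun p => ∫ y, v y • H (p, a y) ∂μ)
        (∫ y, v y • (fderiv ℝ H (p, a y)).comp (ContinuousLinearMap.inl ℝ E Q) ∂μ) p := by
    intro G _ _ H hH
    have hH' : ContDiffOn ℝ (⊤ : ℕ∞)
        (fun z => (fderiv ℝ H z).comp (ContinuousLinearMap.inl ℝ E Q)) W :=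
      (hH.fderiv_of_isOpen hW (by simp)).clm_comp contDiffOn_const
    refine ⟨hH', fun p hp => hasFDerivAt_integral_smul_of_isCompact hv ha hK haK hW
      hH.continuousOn hH'.continuousOn (fun z hz => ?_) (hUW p hp)⟩
    have hz' : HasFDerivAt H (fderiv ℝ H z) (z.1, z.2) :=
      ((hH.contDiffAt (hW.mem_nhds hz)).differentiableAt (by simp)).hasFDerivAt
    exact hz'.comp z.1 (hasFDerivAt_prodMk_left z.1 z.2)
  induction n with
  | zero =>
    intro G _ _ H hH
    exact contDiffOn_zero.2 fun p hp => ((key hH).2 p hp).continuousAt.continuousWithinAt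
  | succ n ih =>
    intro G _ _ H hH
    obtain ⟨hH', hd⟩ := key hH
    push_cast
    refine (contDiffOn_succ_iff_fderiv_of_isOpen hU).2
      ⟨fun p hp => (hd p hp).differentiableAt.differentiableWithinAt, by simp, ?_⟩
    exact (ih hH').congr fun p hp => (hd p hp).fderiv

/-- First and second derivatives of the integral of a power of a quadratic polynomial. -/
lemma deriv_integral_mul_quadratic_rpow
    (hv : Integrable v μ) (ha : Continuous a) (hK : IsCompact K) (haK : ∀ y, a y ∈ K)
    {A B C : Q → ℝ} (hA : Continuous A) (hB : Continuous B) (hC : Continuous C) (r s₀ : ℝ)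
    (hpos : ∀ q ∈ K, 0 < A q + B q * s₀ + C q * s₀ ^ 2) :
    deriv (fun s => ∫ y, v y * (A (a y) + B (a y) * s + C (a y) * s ^ 2) ^ r ∂μ) s₀ =
      ∫ y, v y * (r * (B (a y) + 2 * C (a y) * s₀) *
        (A (a y) + B (a y) * s₀ + C (a y) * s₀ ^ 2) ^ (r - 1)) ∂μ ∧
    iteratedDeriv 2 (fun s => ∫ y, v y * (A (a y) + B (a y) * s + C (a y) * s ^ 2) ^ r ∂μ) s₀ =
      ∫ y, v y * (r * (r - 1) * (B (a y) + 2 * C (a y) * s₀) ^ 2 *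
        (A (a y) + B (a y) * s₀ + C (a y) * s₀ ^ 2) ^ (r - 2) + r * (2 * C (a y)) *
        (A (a y) + B (a y) * s₀ + C (a y) * s₀ ^ 2) ^ (r - 1)) ∂μ := by
  set h : ℝ × Q → ℝ := fun z => A z.2 + B z.2 * z.1 + C z.2 * z.1 ^ 2
  have hc : Continuous h := by fun_prop
  have hW : IsOpen {z | 0 < h z} := isOpen_lt continuous_const hc
  have hpow : ∀ e : ℝ, ContinuousOn (fun z => h z ^ e) {z | 0 < h z} := fun e =>
    hc.continuousOn.rpow_const fun z hz => Or.inl (ne_of_gt hz)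
  have hlin : ContinuousOn (fun z : ℝ × Q => B z.2 + 2 * C z.2 * z.1) {z | 0 < h z} := by
    fun_prop
  have hdh : ∀ z : ℝ × Q,
      HasDerivAt (fun s => h (s, z.2)) (B z.2 + 2 * C z.2 * z.1) z.1 := by
    intro z
    have := (((hasDerivAt_id z.1).const_mul (B z.2)).const_add (A z.2)).add
      (((hasDerivAt_id z.1).pow 2).const_mul (C z.2))
    refine this.congr_deriv ?_
    simp
    ring
  have hd1 : ∀ (e : ℝ), ∀ z ∈ {z | 0 < h z}, HasDerivAt (fun s => h (s, z.2) ^ e)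
      (e * (B z.2 + 2 * C z.2 * z.1) * h z ^ (e - 1)) z.1 := by
    intro e z hz
    refine ((hdh z).rpow_const (p := e) (Or.inl (ne_of_gt hz))).congr_deriv ?_
    ring
  have first : ∀ s, (∀ q ∈ K, 0 < h (s, q)) →
      HasDerivAt (fun s => ∫ y, v y * h (s, a y) ^ r ∂μ)
      (∫ y, v y * (r * (B (a y) + 2 * C (a y) * s) * h (s, a y) ^ (r - 1)) ∂μ) s := fun s hs =>
    hasDerivAt_integral_mul_of_isCompact hv ha hK haK hW (H := fun z => h z ^ r)
      (H' := fun z => r * (B z.2 + 2 * C z.2 * z.1) * h z ^ (r - 1)) (hpow r)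
      ((continuousOn_const.mul hlin).mul (hpow _)) (hd1 r) hs
  have hev : ∀ᶠ s in 𝓝 s₀, ∀ q ∈ K, 0 < h (s, q) :=
    hK.eventually_forall_of_forall_eventually fun q hq => hW.mem_nhds (hpos q hq)
  refine ⟨(first s₀ hpos).deriv, ?_⟩
  rw [iteratedDeriv_succ, iteratedDeriv_one]
  refine Eq.trans (Filter.EventuallyEq.deriv_eq (hev.mono fun s hs => (first s hs).deriv)) ?_
  refine (hasDerivAt_integral_mul_of_isCompact hv ha hK haK hW
      (H := fun z => r * (B z.2 + 2 * C z.2 * z.1) * h z ^ (r - 1))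
      (H' := fun z => r * (r - 1) * (B z.2 + 2 * C z.2 * z.1) ^ 2 * h z ^ (r - 2) +
        r * (2 * C z.2) * h z ^ (r - 1))
      ((continuousOn_const.mul hlin).mul (hpow _)) ?_ ?_ hpos).deriv
  · exact ((continuousOn_const.mul (hlin.pow 2)).mul (hpow _)).add
      ((by fun_prop : ContinuousOn (fun z : ℝ × Q => r * (2 * C z.2)) _).mul (hpow _))
  · intro z hz
    have hl : HasDerivAt (fun s => r * (B z.2 + 2 * C z.2 * s)) (r * (2 * C z.2)) z.1 := by
      simpa using (((hasDerivAt_id z.1).const_mul (2 * C z.2)).const_add (B z.2)).const_mul r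
    refine (hl.mul (hd1 (r - 1) z hz)).congr_deriv ?_
    rw [show r - 1 - 1 = r - 2 by ring]
    ring

end ParametricIntegral

section Kernel

variable {V : Type*} [NormedAddCommGroup V] [InnerProductSpace ℝ V]

/-- Inverse stereographic parametrization of the sphere of diameter one through the origin. -/
def sphereParam (y : V) : ℝ × V := ((1 + ‖y‖ ^ 2)⁻¹, (1 + ‖y‖ ^ 2)⁻¹ • y)

variable (V) in
/-- The sphere of diameter one tangent to `{0} × V` at the origin. -/
def tangentSphere : Set (ℝ × V) := {q | q.1 ^ 2 + ‖q.2‖ ^ 2 = q.1}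

/-- The rescaled quadratic kernel `(‖x - y‖² + t²) / (1 + ‖y‖²)` written in terms of the
parameter `sphereParam y`. -/
def quadKernel (z : (V × ℝ) × (ℝ × V)) : ℝ :=
  (‖z.1.1‖ ^ 2 + z.1.2 ^ 2 - 1) * z.2.1 - 2 * inner ℝ z.1.1 z.2.2 + 1

lemma continuous_sphereParam : Continuous (sphereParam : V → ℝ × V) := by
  have h : Continuous fun y : V => (1 + ‖y‖ ^ 2)⁻¹ :=
    (by fun_prop : Continuous fun y : V => 1 + ‖y‖ ^ 2).inv₀ fun y => by positivity
  exact h.prodMk (h.smul continuous_id)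

lemma sphereParam_mem (y : V) : sphereParam y ∈ tangentSphere V := by
  have h : (1 + ‖y‖ ^ 2) ≠ 0 := by positivity
  simp only [sphereParam, tangentSphere, mem_ofPred_eq, norm_smul, mul_pow, norm_inv,
    Real.norm_eq_abs, sq_abs, inv_pow]
  field_simp

lemma isCompact_tangentSphere [FiniteDimensional ℝ V] : IsCompact (tangentSphere V) := by
  refine Metric.isCompact_of_isClosed_isBounded
    (isClosed_eq (by fun_prop) (by fun_prop)) ?_
  refine (Metric.isBounded_closedBall (x := (0 : ℝ × V)) (r := 1)).subset fun q hq => ?_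
  have hq' : q.1 ^ 2 + ‖q.2‖ ^ 2 = q.1 := hq
  rw [mem_closedBall_zero_iff, Prod.norm_def, sup_le_iff, Real.norm_eq_abs, abs_le]
  refine ⟨⟨?_, ?_⟩, ?_⟩ <;> nlinarith [sq_nonneg q.1, sq_nonneg ‖q.2‖, sq_nonneg (q.1 - 1)]

lemma contDiff_quadKernel {n : WithTop ℕ∞} :
    ContDiff ℝ n (quadKernel : (V × ℝ) × (ℝ × V) → ℝ) := by
  unfold quadKernel
  have h1 : ContDiff ℝ n fun z : (V × ℝ) × (ℝ × V) => z.1.1 := contDiff_fst.comp contDiff_fst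
  have h2 : ContDiff ℝ n fun z : (V × ℝ) × (ℝ × V) => z.1.2 := contDiff_snd.comp contDiff_fst
  have h3 : ContDiff ℝ n fun z : (V × ℝ) × (ℝ × V) => z.2.1 := contDiff_fst.comp contDiff_snd
  have h4 : ContDiff ℝ n fun z : (V × ℝ) × (ℝ × V) => z.2.2 := contDiff_snd.comp contDiff_snd
  exact (((((h1.norm_sq ℝ).add (h2.pow 2)).sub contDiff_const).mul h3).sub
    (contDiff_const.mul (h1.inner ℝ h4))).add contDiff_const

lemma norm_smul_sub_sq_add {x β : V} {α : ℝ} (t : ℝ) (h : (α, β) ∈ tangentSphere V) :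
    ‖α • x - β‖ ^ 2 + t ^ 2 * α ^ 2 = α * quadKernel ((x, t), (α, β)) := by
  have h' : α ^ 2 + ‖β‖ ^ 2 = α := h
  rw [norm_sub_sq_real, norm_smul, inner_smul_left, mul_pow, Real.norm_eq_abs, sq_abs]
  simp only [quadKernel, conj_trivial]
  linear_combination h'

lemma quadKernel_pos {x : V} {t : ℝ} (ht : 0 < t) {q : ℝ × V} (hq : q ∈ tangentSphere V) :
    0 < quadKernel ((x, t), q) := by
  obtain ⟨α, β⟩ := q
  have h := norm_smul_sub_sq_add (x := x) t hq
  have h' : α ^ 2 + ‖β‖ ^ 2 = α := hq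
  have hα : 0 ≤ α := by nlinarith [sq_nonneg α, sq_nonneg ‖β‖]
  rcases hα.eq_or_lt with rfl | hα
  · have : β = 0 := by simpa using h'
    simp [quadKernel, this]
  · refine pos_of_mul_pos_right (h ▸ ?_) hα.le
    positivity

lemma norm_sub_sq_add_eq (x y : V) (t : ℝ) :
    ‖x - y‖ ^ 2 + t ^ 2 = (1 + ‖y‖ ^ 2) * quadKernel ((x, t), sphereParam y) := by
  have h : (1 + ‖y‖ ^ 2) ≠ 0 := by positivity
  simp only [quadKernel, sphereParam, inner_smul_right]
  rw [norm_sub_sq_real]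
  field_simp
  ring

end Kernel

section Extension

variable {N : ℕ} {u : EuclideanSpace ℝ (Fin N) → ℝ}

lemma MemL10.integrable_weight (hu : MemL10 N u) :
    Integrable (fun y => u y * (1 + ‖y‖ ^ 2) ^ (-(N : ℝ) / 2)) volume := by
  refine Integrable.mono' (hu.2.const_mul ((2 : ℝ) ^ ((N : ℝ) / 2))) ?_ ?_
  · refine hu.1.aestronglyMeasurable.mul (Continuous.aestronglyMeasurable ?_)
    exact (by fun_prop : Continuous fun y : EuclideanSpace ℝ (Fin N) => 1 + ‖y‖ ^ 2).rpow_const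
      fun y => Or.inl (by positivity)
  · filter_upwards with y
    have h1 : (0 : ℝ) < 1 + ‖y‖ ^ 2 := by positivity
    have h2 : (0 : ℝ) < 1 + ‖y‖ := by positivity
    rw [norm_mul, Real.norm_eq_abs, Real.norm_eq_abs, abs_of_pos (rpow_pos_of_pos h1 _),
      ← mul_assoc, mul_comm |u y|]
    gcongr
    have h3 : (1 + ‖y‖) ^ (-(N : ℝ)) = ((1 + ‖y‖) ^ 2) ^ (-(N : ℝ) / 2) := by
      rw [← rpow_natCast, ← rpow_mul h2.le]
      congr 1
      push_cast
      ring
    have h4 : (2 : ℝ) ^ ((N : ℝ) / 2) = (2⁻¹ : ℝ) ^ (-(N : ℝ) / 2) := by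
      rw [inv_rpow (by norm_num), neg_div, rpow_neg (by norm_num), inv_inv]
    rw [h3, h4, ← mul_rpow (by norm_num) (by positivity)]
    refine rpow_le_rpow_of_nonpos (by positivity) ?_ ?_
    · nlinarith [sq_nonneg (1 - ‖y‖)]
    · have : (0 : ℝ) ≤ N := N.cast_nonneg
      linarith

lemma mul_rpow_eq_weight_mul (u : EuclideanSpace ℝ (Fin N) → ℝ) (x y : EuclideanSpace ℝ (Fin N))
    {t : ℝ} (ht : 0 < t) :
    u y * (‖x - y‖ ^ 2 + t ^ 2) ^ (-(N : ℝ) / 2) =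
      u y * (1 + ‖y‖ ^ 2) ^ (-(N : ℝ) / 2) *
        quadKernel ((x, t), sphereParam y) ^ (-(N : ℝ) / 2) := by
  rw [norm_sub_sq_add_eq, mul_rpow (by positivity) (quadKernel_pos ht (sphereParam_mem y)).le,
    mul_assoc]

lemma poissonExt_eq (u : EuclideanSpace ℝ (Fin N) → ℝ) (x : EuclideanSpace ℝ (Fin N))
    {t : ℝ} (ht : 0 < t) :
    poissonExt N u x t = cN N / 2 * ∫ y, u y * (1 + ‖y‖ ^ 2) ^ (-(N : ℝ) / 2) *
        quadKernel ((x, t), sphereParam y) ^ (-(N : ℝ) / 2) := by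
  simp only [poissonExt, mul_rpow_eq_weight_mul u x _ ht]

lemma MemL10.integrable_kernel (hu : MemL10 N u) (x : EuclideanSpace ℝ (Fin N)) {t : ℝ}
    (ht : 0 < t) :
    Integrable (fun y => u y * (‖x - y‖ ^ 2 + t ^ 2) ^ (-(N : ℝ) / 2)) volume := by
  simp only [mul_rpow_eq_weight_mul u x _ ht]
  refine integrable_smul_comp_of_isCompact hu.integrable_weight continuous_sphereParam
    isCompact_tangentSphere sphereParam_mem
    (f := fun q => quadKernel ((x, t), q) ^ (-(N : ℝ) / 2)) ?_
  exact ((contDiff_quadKernel (n := 0)).continuous.comp (by fun_prop)).continuousOn.rpow_const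
    fun q hq => Or.inl (quadKernel_pos ht hq).ne'

lemma MemL10.contDiffOn_poissonExt (hu : MemL10 N u) :
    ContDiffOn ℝ (⊤ : ℕ∞)
      (fun p : EuclideanSpace ℝ (Fin N) × ℝ => poissonExt N u p.1 p.2)
      {p : EuclideanSpace ℝ (Fin N) × ℝ | 0 < p.2} := by
  refine contDiffOn_infty.2 fun n => ?_
  have hW : IsOpen {z : (EuclideanSpace ℝ (Fin N) × ℝ) × (ℝ × EuclideanSpace ℝ (Fin N)) |
      0 < quadKernel z} := isOpen_lt continuous_const (contDiff_quadKernel (n := 0)).continuous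
  have h := contDiffOn_nat_integral_smul_of_isCompact hu.integrable_weight continuous_sphereParam
    isCompact_tangentSphere sphereParam_mem hW
    (isOpen_lt continuous_const continuous_snd :
      IsOpen {p : EuclideanSpace ℝ (Fin N) × ℝ | 0 < p.2})
    (fun p hp q hq => quadKernel_pos hp hq) n (H := fun z => quadKernel z ^ (-(N : ℝ) / 2))
    (contDiff_quadKernel.contDiffOn.rpow_const_of_ne fun z hz => ne_of_gt hz)
  exact (contDiffOn_const.mul h).congr fun p hp => poissonExt_eq u p.1 hp

lemma MemL10.iteratedDeriv_two_poissonExt_line (hu : MemL10 N u) (x : EuclideanSpace ℝ (Fin N))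
    {t : ℝ} (ht : 0 < t) (i : Fin N) :
    iteratedDeriv 2 (fun s : ℝ => poissonExt N u (x + s • EuclideanSpace.single i (1 : ℝ)) t) 0 =
      cN N / 2 * ∫ y, u y * (1 + ‖y‖ ^ 2) ^ (-(N : ℝ) / 2) *
        (-(N : ℝ) / 2 * (-(N : ℝ) / 2 - 1) *
          (2 * (x i * (sphereParam y).1 - (sphereParam y).2 i)) ^ 2 *
          quadKernel ((x, t), sphereParam y) ^ (-(N : ℝ) / 2 - 2) +
          -(N : ℝ) / 2 * (2 * (sphereParam y).1) *
          quadKernel ((x, t), sphereParam y) ^ (-(N : ℝ) / 2 - 1)) := by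
  have hq : ∀ (s : ℝ) (q : ℝ × EuclideanSpace ℝ (Fin N)),
      quadKernel ((x + s • EuclideanSpace.single i (1 : ℝ), t), q) =
        quadKernel ((x, t), q) + 2 * (x i * q.1 - q.2 i) * s + q.1 * s ^ 2 := by
    intro s q
    simp only [quadKernel, norm_add_sq_real, inner_add_left, inner_smul_left, inner_smul_right,
      norm_smul, EuclideanSpace.inner_single_left, EuclideanSpace.inner_single_right,
      PiLp.norm_single, mul_pow, Real.norm_eq_abs, sq_abs, conj_trivial, map_one,
      norm_one]
    simp
    ring
  have h := (deriv_integral_mul_quadratic_rpow hu.integrable_weight continuous_sphereParam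
    isCompact_tangentSphere sphereParam_mem
    (A := fun q => quadKernel ((x, t), q)) (B := fun q => 2 * (x i * q.1 - q.2 i))
    (C := fun q => q.1) ((contDiff_quadKernel (n := 0)).continuous.comp (by fun_prop))
    (by fun_prop) (by fun_prop) (-(N : ℝ) / 2) 0
    (fun q hq => by simpa using quadKernel_pos ht hq)).2
  simp only [poissonExt_eq u _ ht, hq]
  rw [iteratedDeriv_const_mul_field, h]
  simp

lemma MemL10.deriv_poissonExt_vertical (hu : MemL10 N u) (x : EuclideanSpace ℝ (Fin N))
    {t : ℝ} (ht : 0 < t) :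
    deriv (fun τ : ℝ => poissonExt N u x τ) t =
      cN N / 2 * ∫ y, u y * (1 + ‖y‖ ^ 2) ^ (-(N : ℝ) / 2) *
        (-(N : ℝ) / 2 * (2 * (sphereParam y).1 * t) *
          quadKernel ((x, t), sphereParam y) ^ (-(N : ℝ) / 2 - 1)) ∧
    iteratedDeriv 2 (fun τ : ℝ => poissonExt N u x τ) t =
      cN N / 2 * ∫ y, u y * (1 + ‖y‖ ^ 2) ^ (-(N : ℝ) / 2) *
        (-(N : ℝ) / 2 * (-(N : ℝ) / 2 - 1) * (2 * (sphereParam y).1 * t) ^ 2 *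
          quadKernel ((x, t), sphereParam y) ^ (-(N : ℝ) / 2 - 2) +
          -(N : ℝ) / 2 * (2 * (sphereParam y).1) *
          quadKernel ((x, t), sphereParam y) ^ (-(N : ℝ) / 2 - 1)) := by
  have hq : ∀ (s : ℝ) (q : ℝ × EuclideanSpace ℝ (Fin N)),
      quadKernel ((x, s), q) = quadKernel ((x, 0), q) + 0 * s + q.1 * s ^ 2 := by
    intro s q
    simp only [quadKernel]
    ring
  have h := deriv_integral_mul_quadratic_rpow hu.integrable_weight continuous_sphereParam
    isCompact_tangentSphere sphereParam_mem
    (A := fun q => quadKernel ((x, 0), q)) (B := fun q => 0)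
    (C := fun q => q.1) ((contDiff_quadKernel (n := 0)).continuous.comp (by fun_prop))
    (by fun_prop) (by fun_prop) (-(N : ℝ) / 2) t
    (fun q h => by simpa only [← hq] using quadKernel_pos ht h)
  simp only [← hq, zero_add] at h
  have hev : (fun τ : ℝ => poissonExt N u x τ) =ᶠ[𝓝 t] fun τ => cN N / 2 *
      ∫ y, u y * (1 + ‖y‖ ^ 2) ^ (-(N : ℝ) / 2) *
        quadKernel ((x, τ), sphereParam y) ^ (-(N : ℝ) / 2) := by
    filter_upwards [lt_mem_nhds ht] with τ hτ using poissonExt_eq u x hτ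
  rw [hev.deriv_eq, hev.iteratedDeriv_eq 2, deriv_const_mul_field, iteratedDeriv_const_mul_field,
    h.1, h.2]
  exact ⟨rfl, rfl⟩

/-- The pointwise identity behind the equation: each kernel solves it. -/
lemma kernel_equation (x : EuclideanSpace ℝ (Fin N)) {t : ℝ} (ht : 0 < t)
    {q : ℝ × EuclideanSpace ℝ (Fin N)} (hq : q ∈ tangentSphere (EuclideanSpace ℝ (Fin N))) :
    t * (∑ i : Fin N, (-(N : ℝ) / 2 * (-(N : ℝ) / 2 - 1) *
          (2 * (x i * q.1 - q.2 i)) ^ 2 * quadKernel ((x, t), q) ^ (-(N : ℝ) / 2 - 2) +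
          -(N : ℝ) / 2 * (2 * q.1) * quadKernel ((x, t), q) ^ (-(N : ℝ) / 2 - 1))) +
      t * (-(N : ℝ) / 2 * (-(N : ℝ) / 2 - 1) * (2 * q.1 * t) ^ 2 *
          quadKernel ((x, t), q) ^ (-(N : ℝ) / 2 - 2) +
          -(N : ℝ) / 2 * (2 * q.1) * quadKernel ((x, t), q) ^ (-(N : ℝ) / 2 - 1)) +
      -(N : ℝ) / 2 * (2 * q.1 * t) * quadKernel ((x, t), q) ^ (-(N : ℝ) / 2 - 1) = 0 := by
  have hpos := quadKernel_pos (x := x) ht hq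
  have hpow : quadKernel ((x, t), q) ^ (-(N : ℝ) / 2 - 1) =
      quadKernel ((x, t), q) ^ (-(N : ℝ) / 2 - 2) * quadKernel ((x, t), q) := by
    rw [← rpow_add_one hpos.ne']
    congr 1
    ring
  have hsum : ∑ i : Fin N, (2 * (x i * q.1 - q.2 i)) ^ 2 = 4 * ‖q.1 • x - q.2‖ ^ 2 := by
    rw [EuclideanSpace.norm_sq_eq, Finset.mul_sum]
    refine Finset.sum_congr rfl fun i _ => ?_
    simp only [PiLp.sub_apply, PiLp.smul_apply, smul_eq_mul, Real.norm_eq_abs, sq_abs]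
    ring
  have hk := norm_smul_sub_sq_add (x := x) t hq
  rw [Finset.sum_add_distrib, ← Finset.sum_mul, ← Finset.mul_sum, hsum, hpow]
  simp only [Finset.sum_const, Finset.card_univ, Fintype.card_fin, nsmul_eq_mul]
  linear_combination (4 * t * (-(N : ℝ) / 2 * (-(N : ℝ) / 2 - 1)) *
    quadKernel ((x, t), q) ^ (-(N : ℝ) / 2 - 2)) * hk

lemma MemL10.poissonExt_equation (hu : MemL10 N u) (x : EuclideanSpace ℝ (Fin N)) {t : ℝ}
    (ht : 0 < t) :
    t * (∑ i : Fin N, iteratedDeriv 2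
          (fun s : ℝ => poissonExt N u (x + s • EuclideanSpace.single i (1 : ℝ)) t) 0)
      + t * iteratedDeriv 2 (fun τ : ℝ => poissonExt N u x τ) t
      + deriv (fun τ : ℝ => poissonExt N u x τ) t = 0 := by
  have hint : ∀ f : ℝ × EuclideanSpace ℝ (Fin N) → ℝ,
      ContinuousOn f (tangentSphere (EuclideanSpace ℝ (Fin N))) →
      Integrable (fun y => u y * (1 + ‖y‖ ^ 2) ^ (-(N : ℝ) / 2) * f (sphereParam y)) volume :=
    fun f hf => integrable_smul_comp_of_isCompact hu.integrable_weight continuous_sphereParam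
      isCompact_tangentSphere sphereParam_mem hf
  have hpow : ∀ r : ℝ, ContinuousOn (fun q => quadKernel ((x, t), q) ^ r)
      (tangentSphere (EuclideanSpace ℝ (Fin N))) := fun r =>
    ((contDiff_quadKernel (n := 0)).continuous.comp (by fun_prop)).continuousOn.rpow_const
      fun q hq => Or.inl (quadKernel_pos ht hq).ne'
  have h1 := hpow (-(N : ℝ) / 2 - 1)
  have h2 := hpow (-(N : ℝ) / 2 - 2)
  simp only [hu.iteratedDeriv_two_poissonExt_line x ht, (hu.deriv_poissonExt_vertical x ht).1,
    (hu.deriv_poissonExt_vertical x ht).2]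
  have i1 : ∀ i : Fin N, _ := fun i => hint (fun q =>
    -(N : ℝ) / 2 * (-(N : ℝ) / 2 - 1) * (2 * (x i * q.1 - q.2 i)) ^ 2 *
      quadKernel ((x, t), q) ^ (-(N : ℝ) / 2 - 2) + -(N : ℝ) / 2 * (2 * q.1) *
      quadKernel ((x, t), q) ^ (-(N : ℝ) / 2 - 1)) (by fun_prop)
  have i2 := hint (fun q =>
    -(N : ℝ) / 2 * (-(N : ℝ) / 2 - 1) * (2 * q.1 * t) ^ 2 *
      quadKernel ((x, t), q) ^ (-(N : ℝ) / 2 - 2) + -(N : ℝ) / 2 * (2 * q.1) *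
      quadKernel ((x, t), q) ^ (-(N : ℝ) / 2 - 1)) (by fun_prop)
  have i3 := hint (fun q => -(N : ℝ) / 2 * (2 * q.1 * t) *
      quadKernel ((x, t), q) ^ (-(N : ℝ) / 2 - 1)) (by fun_prop)
  have i4 := ((integrable_finsetSum Finset.univ fun i _ => i1 i).const_mul t).add (i2.const_mul t)
  simp only [Pi.add_def] at i4
  rw [← Finset.mul_sum, ← integral_finsetSum _ fun i _ => i1 i, mul_left_comm t,
    mul_left_comm t, ← mul_add, ← mul_add, ← integral_const_mul, ← integral_const_mul,
    ← integral_add ((integrable_finsetSum _ fun i _ => i1 i).const_mul t) (i2.const_mul t),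
    ← integral_add i4 i3]
  refine mul_eq_zero_of_right _ (integral_eq_zero_of_ae (Eventually.of_forall fun y => ?_))
  have hk := kernel_equation x ht (sphereParam_mem y)
  simp only [Pi.zero_apply]
  rw [← Finset.mul_sum]
  linear_combination (u y * (1 + ‖y‖ ^ 2) ^ (-(N : ℝ) / 2)) * hk

end Extension

/-- for `u ∈ L^1_0(ℝ^N)`, the Poisson-type extension `w_u` is well
defined and smooth on the upper half-space, and it is a classical solution of
`div(t ∇ w_u) = 0` there, i.e.
`t Δ_x w_u + t ∂_t² w_u + ∂_t w_u = 0` on `ℝ^N × (0,∞)`. -/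
theorem stmt0 (N : ℕ) (hN : 1 ≤ N) (u : EuclideanSpace ℝ (Fin N) → ℝ)
    (hu : MemL10 N u) :
    (∀ (x : EuclideanSpace ℝ (Fin N)) (t : ℝ), 0 < t →
      MeasureTheory.Integrable
        (fun y => u y * (‖x - y‖ ^ 2 + t ^ 2) ^ (-(N : ℝ) / 2)) volume) ∧
    ContDiffOn ℝ (⊤ : ℕ∞)
      (fun p : EuclideanSpace ℝ (Fin N) × ℝ => poissonExt N u p.1 p.2)
      {p : EuclideanSpace ℝ (Fin N) × ℝ | 0 < p.2} ∧
    (∀ (x : EuclideanSpace ℝ (Fin N)) (t : ℝ), 0 < t →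
      t * (∑ i : Fin N, iteratedDeriv 2
            (fun s : ℝ => poissonExt N u (x + s • EuclideanSpace.single i (1 : ℝ)) t) 0)
        + t * iteratedDeriv 2 (fun τ : ℝ => poissonExt N u x τ) t
        + deriv (fun τ : ℝ => poissonExt N u x τ) t = 0) := by
  exact ⟨fun x t ht => hu.integrable_kernel x ht, hu.contDiffOn_poissonExt,
    fun x t ht => hu.poissonExt_equation x ht⟩
end
end

section
/- Let N ≥ 1 be an integer and let u ∈ L^1_0(ℝ^N). Then the extension w_u attains u as inhomogeneous Neumann datum in L^1_loc: for every R > 0, lim_{t→0⁺} ∫_{B_R(0)} | t ∂_t w_u(x,t) + u(x) | dx = 0. -/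
open MeasureTheory Real Filter Topology Set Metric

noncomputable section

/-- The kernel whose convolution with `u` is `-t ∂_t w_u(·,t)`. -/
def neumannKernel (N : ℕ) (t : ℝ) (z : EuclideanSpace ℝ (Fin N)) : ℝ :=
  cN N * N / 2 * t ^ 2 * (‖z‖ ^ 2 + t ^ 2) ^ (-(N : ℝ) / 2 - 1)

lemma cN_pos {N : ℕ} (hN : 1 ≤ N) : 0 < cN N := by
  have : (0 : ℝ) < N := by exact_mod_cast hN
  unfold cN
  exact div_pos (Real.Gamma_pos_of_pos (by positivity)) (by positivity)

lemma neumannKernel_nonneg {N : ℕ} (hN : 1 ≤ N) (t : ℝ) (z : EuclideanSpace ℝ (Fin N)) :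
    0 ≤ neumannKernel N t z := by
  have := (cN_pos hN).le
  unfold neumannKernel
  positivity

lemma continuous_sq_add_sq_rpow {E : Type*} [SeminormedAddCommGroup E] {t : ℝ} (ht : 0 < t)
    (p : ℝ) : Continuous fun z : E => (‖z‖ ^ 2 + t ^ 2) ^ p :=
  (by fun_prop : Continuous fun z : E => ‖z‖ ^ 2 + t ^ 2).rpow_const
    fun z => Or.inl (by positivity)

lemma continuous_neumannKernel (N : ℕ) {t : ℝ} (ht : 0 < t) :
    Continuous (neumannKernel N t) :=
  continuous_const.mul (continuous_sq_add_sq_rpow ht _)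

lemma hasDerivAt_radial_primitive (N : ℕ) (hN : 1 ≤ N) {r : ℝ} :
    HasDerivAt (fun r : ℝ => r ^ N * (r ^ 2 + 1) ^ (-(N : ℝ) / 2))
      (r ^ (N - 1) * (N * (r ^ 2 + 1) ^ (-(N : ℝ) / 2 - 1))) r := by
  have hpos : 0 < r ^ 2 + 1 := by positivity
  have h1 : HasDerivAt (fun r : ℝ => r ^ 2 + 1) (2 * r) r := by
    simpa using (hasDerivAt_pow 2 r).add_const 1
  have h2 := (hasDerivAt_pow N r).mul (h1.rpow_const (p := -(N : ℝ) / 2) (Or.inl hpos.ne'))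
  refine h2.congr_deriv ?_
  obtain ⟨n, rfl⟩ : ∃ n, N = n + 1 := ⟨N - 1, by omega⟩
  rw [show (r ^ 2 + 1) ^ (-((n + 1 : ℕ) : ℝ) / 2)
    = (r ^ 2 + 1) ^ (-((n + 1 : ℕ) : ℝ) / 2 - 1) * (r ^ 2 + 1) by
      rw [rpow_sub_one hpos.ne']; field_simp]
  simp only [Nat.add_sub_cancel]
  ring

lemma tendsto_radial_primitive (N : ℕ) :
    Tendsto (fun r : ℝ => r ^ N * (r ^ 2 + 1) ^ (-(N : ℝ) / 2)) atTop (𝓝 1) := by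
  have h1 : Tendsto (fun r : ℝ => 1 + (r ^ 2)⁻¹) atTop (𝓝 (1 + 0)) :=
    tendsto_const_nhds.add (tendsto_inv_atTop_zero.comp (tendsto_pow_atTop two_ne_zero))
  have h2 := h1.rpow_const (p := -(N : ℝ) / 2) (Or.inl (by norm_num))
  rw [add_zero, one_rpow] at h2
  refine h2.congr' ?_
  filter_upwards [eventually_gt_atTop 0] with r hr
  rw [show r ^ 2 + 1 = r ^ 2 * (1 + (r ^ 2)⁻¹) by field_simp, mul_rpow (by positivity)
    (by positivity), ← rpow_natCast r 2, ← rpow_mul hr.le, ← mul_assoc, ← rpow_natCast r N,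
    ← rpow_add hr]
  rw [show (N : ℝ) + ((2 : ℕ) : ℝ) * (-(N : ℝ) / 2) = 0 by push_cast; ring, rpow_zero, one_mul]

lemma integral_neumannKernel_one {N : ℕ} (hN : 1 ≤ N) : ∫ z, neumannKernel N 1 z = 1 := by
  have hN0 : (0 : ℝ) < N := by exact_mod_cast hN
  have : Nonempty (Fin N) := ⟨⟨0, hN⟩⟩
  have : Nontrivial (EuclideanSpace ℝ (Fin N)) := by
    apply Module.nontrivial_of_finrank_pos (R := ℝ)
    rw [finrank_euclideanSpace_fin]
    exact hN
  have hrad : ∫ r in Ioi (0 : ℝ), r ^ (N - 1) * (N * (r ^ 2 + 1) ^ (-(N : ℝ) / 2 - 1)) = 1 := by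
    rw [integral_Ioi_of_hasDerivAt_of_nonneg' (fun r _ => hasDerivAt_radial_primitive N hN)
      (fun r hr => ?_) (tendsto_radial_primitive N)]
    · simp [show N ≠ 0 by omega]
    · have : 0 < r := hr
      positivity
  have h := integral_fun_norm_addHaar (volume : Measure (EuclideanSpace ℝ (Fin N)))
    (fun r => (N : ℝ) * (r ^ 2 + 1) ^ (-(N : ℝ) / 2 - 1))
  simp only [finrank_euclideanSpace, Fintype.card_fin, smul_eq_mul, hrad, mul_one,
    nsmul_eq_mul] at h
  have hK : ∀ z, neumannKernel N 1 z
      = cN N / 2 * ((N : ℝ) * (‖z‖ ^ 2 + 1) ^ (-(N : ℝ) / 2 - 1)) := by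
    intro z; simp only [neumannKernel, one_pow]; ring
  simp_rw [hK]
  rw [integral_const_mul, h, measureReal_def, EuclideanSpace.volume_ball]
  have hG := Real.Gamma_pos_of_pos (show (0 : ℝ) < N / 2 by positivity)
  rw [Fintype.card_fin, Real.Gamma_add_one (by positivity)]
  simp only [ENNReal.ofReal_one, one_pow, one_mul]
  rw [ENNReal.toReal_ofReal (by positivity), cN, Real.sqrt_eq_rpow, ← rpow_natCast,
    ← rpow_mul Real.pi_pos.le, show (1 : ℝ) / 2 * N = N / 2 by ring]
  have := rpow_pos_of_pos Real.pi_pos ((N : ℝ) / 2)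
  field_simp

lemma neumannKernel_eq_scaled (N : ℕ) {t : ℝ} (ht : 0 < t) (z : EuclideanSpace ℝ (Fin N)) :
    neumannKernel N t z = t⁻¹ ^ N * neumannKernel N 1 (t⁻¹ • z) := by
  unfold neumannKernel
  rw [norm_smul, norm_inv, Real.norm_of_nonneg ht.le,
    show ‖z‖ ^ 2 + t ^ 2 = t ^ 2 * ((t⁻¹ * ‖z‖) ^ 2 + 1 ^ 2) by field_simp,
    mul_rpow (by positivity) (by positivity), ← rpow_natCast t 2, ← rpow_mul ht.le]
  have : t ^ (((2 : ℕ) : ℝ) * (-(N : ℝ) / 2 - 1)) = t⁻¹ ^ N * (t ^ 2)⁻¹ := by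
    rw [show ((2 : ℕ) : ℝ) * (-(N : ℝ) / 2 - 1) = -(N : ℝ) + -((2 : ℕ) : ℝ) by push_cast; ring,
      rpow_add ht, rpow_neg ht.le, rpow_neg ht.le, rpow_natCast, rpow_natCast, inv_pow]
  rw [this, rpow_natCast]
  field_simp

lemma integral_neumannKernel {N : ℕ} (hN : 1 ≤ N) {t : ℝ} (ht : 0 < t) :
    ∫ z, neumannKernel N t z = 1 := by
  simp_rw [neumannKernel_eq_scaled N ht]
  rw [integral_const_mul, Measure.integral_comp_smul, integral_neumannKernel_one hN,
    finrank_euclideanSpace_fin, abs_of_pos (by positivity)]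
  simp only [smul_eq_mul]
  field_simp

lemma lintegral_neumannKernel {N : ℕ} (hN : 1 ≤ N) {t : ℝ} (ht : 0 < t) :
    ∫⁻ z, ‖neumannKernel N t z‖ₑ = 1 := by
  have h := integral_neumannKernel hN ht
  have hi : Integrable (neumannKernel N t) := integrable_of_integral_eq_one h
  rw [← ENNReal.ofReal_one, ← h, ofReal_integral_eq_lintegral_ofReal hi
    (ae_of_all _ (neumannKernel_nonneg hN t))]
  exact lintegral_congr fun z => Real.enorm_of_nonneg (neumannKernel_nonneg hN t z)

lemma tendsto_norm_pow_mul_neumannKernel_one {N : ℕ} (hN : 1 ≤ N) :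
    Tendsto (fun z : EuclideanSpace ℝ (Fin N) => ‖z‖ ^ N * neumannKernel N 1 z)
      (Bornology.cobounded _) (𝓝 0) := by
  have hc := cN_pos hN
  have hlim : Tendsto (fun z : EuclideanSpace ℝ (Fin N) => cN N * N / 2 * (‖z‖ ^ 2)⁻¹)
      (Bornology.cobounded _) (𝓝 0) := by
    have := (tendsto_inv_atTop_zero.comp ((tendsto_pow_atTop (α := ℝ) two_ne_zero).comp
      (tendsto_norm_cobounded_atTop (E := EuclideanSpace ℝ (Fin N))))).const_mul (cN N * N / 2)
    simpa [Function.comp_def] using this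
  refine squeeze_zero' (.of_forall fun z => mul_nonneg (by positivity)
    (neumannKernel_nonneg hN 1 z)) ?_ hlim
  filter_upwards [tendsto_norm_cobounded_atTop.eventually_gt_atTop 0] with z hz
  have h : (‖z‖ ^ 2 + 1 ^ 2) ^ (-(N : ℝ) / 2 - 1) ≤ (‖z‖ ^ 2) ^ (-(N : ℝ) / 2 - 1) :=
    rpow_le_rpow_of_nonpos (by positivity) (by norm_num) (by
      have : (0 : ℝ) ≤ N := by positivity
      linarith)
  have h2 : (‖z‖ ^ 2) ^ (-(N : ℝ) / 2 - 1) = (‖z‖ ^ N)⁻¹ * (‖z‖ ^ 2)⁻¹ := by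
    rw [rpow_sub_one (by positivity), ← rpow_natCast _ 2, ← rpow_mul hz.le,
      show ((2 : ℕ) : ℝ) * (-(N : ℝ) / 2) = -(N : ℝ) by push_cast; ring, rpow_neg hz.le,
      rpow_natCast, rpow_natCast, div_eq_mul_inv]
  rw [h2] at h
  calc ‖z‖ ^ N * neumannKernel N 1 z
      = cN N * N / 2 * (‖z‖ ^ N * (‖z‖ ^ 2 + 1 ^ 2) ^ (-(N : ℝ) / 2 - 1)) := by
        unfold neumannKernel; ring
    _ ≤ cN N * N / 2 * (‖z‖ ^ N * ((‖z‖ ^ N)⁻¹ * (‖z‖ ^ 2)⁻¹)) := by gcongr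
    _ = _ := by field_simp

lemma rpow_neg_half_le {N : ℕ} {C q a : ℝ} (hq : 0 < q) (ha : 0 < a)
    (h : a ≤ C * √q) : q ^ (-(N : ℝ) / 2) ≤ C ^ N * a ^ (-(N : ℝ)) := by
  have hs : 0 < √q := Real.sqrt_pos.2 hq
  have h1 : q ^ (-(N : ℝ) / 2) = (√q ^ N)⁻¹ := by
    rw [Real.sqrt_eq_rpow, ← rpow_natCast, ← rpow_mul hq.le, ← rpow_neg hq.le]
    congr 1; ring
  rw [h1, rpow_neg ha.le, rpow_natCast, ← div_eq_mul_inv, le_div_iff₀ (by positivity),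
    inv_mul_le_iff₀ (by positivity), ← mul_pow, mul_comm]
  gcongr

lemma MemL10.integrable_rpow_mul {N : ℕ} {u : EuclideanSpace ℝ (Fin N) → ℝ} (hu : MemL10 N u)
    (x : EuclideanSpace ℝ (Fin N)) {s : ℝ} (hs : 0 < s) :
    Integrable fun y => u y * (‖x - y‖ ^ 2 + s ^ 2) ^ (-(N : ℝ) / 2) := by
  have hmeas : Continuous fun y => (‖x - y‖ ^ 2 + s ^ 2) ^ (-(N : ℝ) / 2) :=
    (continuous_sq_add_sq_rpow hs _).comp (continuous_const.sub continuous_id)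
  refine (hu.2.const_mul (((1 + ‖x‖) / s + 1) ^ N)).mono'
    (hu.1.aestronglyMeasurable.mul hmeas.aestronglyMeasurable) (ae_of_all _ fun y => ?_)
  have hq : 0 < ‖x - y‖ ^ 2 + s ^ 2 := by positivity
  have h1 : s ≤ √(‖x - y‖ ^ 2 + s ^ 2) := Real.le_sqrt_of_sq_le (by nlinarith [norm_nonneg (x - y)])
  have h2 : ‖x - y‖ ≤ √(‖x - y‖ ^ 2 + s ^ 2) := Real.le_sqrt_of_sq_le (by nlinarith)
  have h3 : ‖y‖ ≤ ‖x‖ + ‖x - y‖ := by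
    rw [norm_sub_rev]; exact norm_le_insert' y x
  have h4 : 1 + ‖x‖ ≤ (1 + ‖x‖) / s * √(‖x - y‖ ^ 2 + s ^ 2) := by
    calc 1 + ‖x‖ = (1 + ‖x‖) / s * s := by field_simp
      _ ≤ _ := by gcongr
  have := rpow_neg_half_le (N := N) (C := (1 + ‖x‖) / s + 1) (a := 1 + ‖y‖) hq
    (by positivity) (by linarith)
  rw [norm_mul, Real.norm_of_nonneg (by positivity : 0 ≤ (‖x - y‖ ^ 2 + s ^ 2) ^ (-(N : ℝ) / 2)),
    Real.norm_eq_abs]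
  calc _ ≤ |u y| * (((1 + ‖x‖) / s + 1) ^ N * (1 + ‖y‖) ^ (-(N : ℝ))) := by gcongr
    _ = _ := by ring

/-- Differentiation under the integral sign: `-t ∂_t w_u` is the convolution of `u` with the
kernel `neumannKernel N t`. -/
lemma MemL10.integrable_neumannKernel_mul_and_deriv {N : ℕ}
    {u : EuclideanSpace ℝ (Fin N) → ℝ} (hu : MemL10 N u) (x : EuclideanSpace ℝ (Fin N))
    {t : ℝ} (ht : 0 < t) :
    Integrable (fun y => neumannKernel N t (x - y) * u y) ∧
      t * deriv (fun τ => poissonExt N u x τ) t = -∫ y, neumannKernel N t (x - y) * u y := by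
  have hcont (p τ : ℝ) (hτ : 0 < τ) : Continuous fun y : EuclideanSpace ℝ (Fin N) =>
      (‖x - y‖ ^ 2 + τ ^ 2) ^ p :=
    (continuous_sq_add_sq_rpow hτ _).comp (continuous_const.sub continuous_id)
  have key := hasDerivAt_integral_of_dominated_loc_of_deriv_le (μ := volume)
    (F := fun τ y => u y * (‖x - y‖ ^ 2 + τ ^ 2) ^ (-(N : ℝ) / 2))
    (F' := fun τ y => u y * (-(N : ℝ) * τ * (‖x - y‖ ^ 2 + τ ^ 2) ^ (-(N : ℝ) / 2 - 1)))
    (bound := fun y => (N * (2 * t) / (t / 2) ^ 2) *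
      ‖u y * (‖x - y‖ ^ 2 + (t / 2) ^ 2) ^ (-(N : ℝ) / 2)‖)
    (x₀ := t) (Metric.ball_mem_nhds t (half_pos ht))
    (by
      filter_upwards [eventually_gt_nhds ht] with τ hτ
      exact hu.1.aestronglyMeasurable.mul (hcont _ τ hτ).aestronglyMeasurable)
    (hu.integrable_rpow_mul x ht)
    (hu.1.aestronglyMeasurable.mul (((hcont _ t ht).const_mul _).aestronglyMeasurable))
    (ae_of_all _ fun y τ hτ => ?_)
    ((hu.integrable_rpow_mul x (half_pos ht)).norm.const_mul _)
    (ae_of_all _ fun y τ hτ => ?_)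
  · obtain ⟨hint, hder⟩ := key
    have hK : ∀ y, neumannKernel N t (x - y) * u y = -(cN N / 2 * t) *
        (u y * (-(N : ℝ) * t * (‖x - y‖ ^ 2 + t ^ 2) ^ (-(N : ℝ) / 2 - 1))) := by
      intro y; unfold neumannKernel; ring
    simp_rw [hK]
    refine ⟨hint.const_mul _, ?_⟩
    have := (hder.const_mul (cN N / 2)).deriv
    simp only [poissonExt, this]
    rw [integral_const_mul]
    ring
  · rw [Metric.mem_ball, Real.dist_eq, abs_lt] at hτ
    have hτ1 : t / 2 < τ := by linarith
    have hτ0 : 0 < τ := by linarith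
    have hN : (0 : ℝ) ≤ N := by positivity
    set q := ‖x - y‖ ^ 2 + (t / 2) ^ 2 with hq
    have hq0 : 0 < q := by positivity
    have h1 : (‖x - y‖ ^ 2 + τ ^ 2) ^ (-(N : ℝ) / 2 - 1) ≤ q ^ (-(N : ℝ) / 2 - 1) :=
      rpow_le_rpow_of_nonpos hq0 (by rw [hq]; gcongr) (by linarith)
    have h2 : q ^ (-(N : ℝ) / 2 - 1) ≤ q ^ (-(N : ℝ) / 2) / (t / 2) ^ 2 := by
      rw [rpow_sub_one hq0.ne']
      gcongr
      rw [hq]; nlinarith [sq_nonneg ‖x - y‖]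
    simp only [norm_mul, norm_neg, Real.norm_eq_abs, Nat.abs_cast, abs_of_pos hτ0]
    rw [abs_of_nonneg (rpow_nonneg (by positivity) (-(N : ℝ) / 2 - 1)),
      abs_of_nonneg (rpow_nonneg hq0.le (-(N : ℝ) / 2))]
    calc _ ≤ |u y| * (N * (2 * t) * (q ^ (-(N : ℝ) / 2) / (t / 2) ^ 2)) := by
          gcongr
          · linarith
          · exact h1.trans h2
      _ = _ := by ring
  · rw [Metric.mem_ball, Real.dist_eq, abs_lt] at hτ
    have hτ0 : 0 < τ := by linarith
    have h1 : HasDerivAt (fun τ : ℝ => ‖x - y‖ ^ 2 + τ ^ 2) (2 * τ) τ := by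
      simpa using (hasDerivAt_pow 2 τ).const_add (‖x - y‖ ^ 2)
    refine ((h1.rpow_const (p := -(N : ℝ) / 2) (Or.inl (by positivity))).const_mul
      (u y)).congr_deriv ?_
    ring

lemma rpow_kernel_le_of_far {E : Type*} [SeminormedAddCommGroup E] (N : ℕ) {R : ℝ} (hR : 0 < R)
    {x y : E} (hx : ‖x‖ < R) (hy : 2 * R ≤ ‖y‖) (t : ℝ) :
    (‖x - y‖ ^ 2 + t ^ 2) ^ (-(N : ℝ) / 2 - 1) ≤
      (R ^ 2)⁻¹ * ((1 / R + 2) ^ N * (1 + ‖y‖) ^ (-(N : ℝ))) := by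
  have h3 : ‖y‖ ≤ ‖x‖ + ‖x - y‖ := by
    rw [norm_sub_rev]; exact norm_le_insert' y x
  have hxy : R ≤ ‖x - y‖ := by linarith
  have hq : 0 < ‖x - y‖ ^ 2 + t ^ 2 := by nlinarith [sq_nonneg t, mul_pos hR hR]
  have h2 : ‖x - y‖ ≤ √(‖x - y‖ ^ 2 + t ^ 2) := Real.le_sqrt_of_sq_le (by nlinarith)
  have h4 : 1 + ‖y‖ ≤ (1 / R + 2) * √(‖x - y‖ ^ 2 + t ^ 2) := by
    calc 1 + ‖y‖ ≤ 1 / R * R + 2 * ‖x - y‖ := by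
          rw [one_div_mul_cancel hR.ne']; linarith
      _ ≤ 1 / R * ‖x - y‖ + 2 * ‖x - y‖ := by gcongr
      _ = (1 / R + 2) * ‖x - y‖ := by ring
      _ ≤ _ := by gcongr
  rw [rpow_sub_one hq.ne', div_eq_inv_mul]
  gcongr
  · nlinarith [sq_nonneg t]
  · exact rpow_neg_half_le hq (by positivity) h4

lemma lintegral_neumannKernel_conv {N : ℕ} (hN : 1 ≤ N) {t : ℝ} (ht : 0 < t)
    {v : EuclideanSpace ℝ (Fin N) → ENNReal} (hv : AEMeasurable v) :
    ∫⁻ x, ∫⁻ y, ‖neumannKernel N t (x - y)‖ₑ * v y = ∫⁻ y, v y := by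
  have hK := (continuous_neumannKernel N ht).measurable
  rw [lintegral_lintegral_swap]
  · refine lintegral_congr fun y => ?_
    rw [lintegral_mul_const _ (by fun_prop),
      lintegral_sub_right_eq_self (fun x => ‖neumannKernel N t x‖ₑ) y,
      lintegral_neumannKernel hN ht, one_mul]
  · exact (by fun_prop : Measurable fun p : EuclideanSpace ℝ (Fin N) × EuclideanSpace ℝ (Fin N) =>
      ‖neumannKernel N t (p.1 - p.2)‖ₑ).aemeasurable.mul hv.comp_snd

lemma tendsto_lintegral_neumannKernel_conv {N : ℕ} (hN : 1 ≤ N)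
    {h : EuclideanSpace ℝ (Fin N) → ℝ} (hc : Continuous h) (hs : HasCompactSupport h) (R : ℝ) :
    Tendsto (fun t => ∫⁻ x in ball (0 : EuclideanSpace ℝ (Fin N)) R,
      ‖h x - ∫ y, neumannKernel N t (x - y) * h y‖ₑ) (𝓝[>] 0) (𝓝 0) := by
  obtain ⟨M, hM⟩ := hs.exists_bound_of_continuous hc
  have hM' : ∀ x, ‖h x‖ₑ ≤ ENNReal.ofReal M := fun x => by
    rw [← ofReal_norm]; exact ENNReal.ofReal_le_ofReal (hM x)
  rw [← lintegral_zero (μ := volume.restrict (ball (0 : EuclideanSpace ℝ (Fin N)) R))]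
  refine tendsto_lintegral_filter_of_dominated_convergence
    (fun _ => ENNReal.ofReal M + ENNReal.ofReal M) ?_ ?_ ?_ (ae_of_all _ fun x => ?_)
  · filter_upwards [self_mem_nhdsWithin] with t ht
    have hK := continuous_neumannKernel N ht
    have : StronglyMeasurable fun x => ∫ y, neumannKernel N t (x - y) * h y :=
      StronglyMeasurable.integral_prod_right
        (by fun_prop : Continuous (Function.uncurry fun x y =>
          neumannKernel N t (x - y) * h y)).stronglyMeasurable
    exact (hc.measurable.sub this.measurable).enorm
  · filter_upwards [self_mem_nhdsWithin] with t ht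
    have hK := (continuous_neumannKernel N ht).measurable
    refine ae_of_all _ fun x => (enorm_sub_le).trans (add_le_add (hM' x) ?_)
    calc _ ≤ ∫⁻ y, ‖neumannKernel N t (x - y) * h y‖ₑ := enorm_integral_le_lintegral_enorm _
      _ ≤ ∫⁻ y, ‖neumannKernel N t (x - y)‖ₑ * ENNReal.ofReal M := by
        refine lintegral_mono fun y => ?_
        rw [enorm_mul]
        gcongr
        exact hM' y
      _ = ENNReal.ofReal M := by
        rw [lintegral_mul_const _ (by fun_prop),
          lintegral_sub_left_eq_self (fun x => ‖neumannKernel N t x‖ₑ) x,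
          lintegral_neumannKernel hN ht, one_mul]
  · rw [lintegral_const, Measure.restrict_apply_univ]
    exact ENNReal.mul_ne_top (by simp) measure_ball_lt_top.ne
  · have h1 := (tendsto_integral_comp_smul_smul_of_integrable' (neumannKernel_nonneg hN 1)
      (integral_neumannKernel_one hN)
      (by simpa using tendsto_norm_pow_mul_neumannKernel_one hN)
      (hc.integrable_of_hasCompactSupport hs) (hc.continuousAt (x := x))).comp
        (tendsto_inv_nhdsGT_zero (𝕜 := ℝ))
    have h2 : Tendsto (fun t => ∫ y, neumannKernel N t (x - y) * h y) (𝓝[>] 0) (𝓝 (h x)) := by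
      refine h1.congr' ?_
      filter_upwards [self_mem_nhdsWithin] with t ht
      simp only [Function.comp_apply, finrank_euclideanSpace_fin, smul_eq_mul]
      simp_rw [neumannKernel_eq_scaled N ht]
    simpa using ((tendsto_const_nhds (x := h x)).sub h2).enorm

lemma lintegral_neumannKernel_mul_far_le {N : ℕ} (hN : 1 ≤ N)
    (u : EuclideanSpace ℝ (Fin N) → ℝ) {R : ℝ} (hR : 0 < R) {x : EuclideanSpace ℝ (Fin N)}
    (hx : x ∈ ball 0 R) (t : ℝ) :
    ∫⁻ y, ‖neumannKernel N t (x - y)‖ₑ * ‖(ball 0 (2 * R))ᶜ.indicator u y‖ₑ ≤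
      ENNReal.ofReal (cN N * N / 2 * t ^ 2 * ((R ^ 2)⁻¹ * (1 / R + 2) ^ N)) *
        ∫⁻ y, ‖(1 + ‖y‖) ^ (-(N : ℝ)) * |u y|‖ₑ := by
  have hc := cN_pos hN
  rw [← lintegral_const_mul' _ _ ENNReal.ofReal_ne_top]
  refine lintegral_mono fun y => ?_
  by_cases hy : y ∈ (ball (0 : EuclideanSpace ℝ (Fin N)) (2 * R))ᶜ
  · rw [indicator_of_mem hy, enorm_mul, ← mul_assoc, enorm_abs,
      Real.enorm_of_nonneg (neumannKernel_nonneg hN _ _),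
      Real.enorm_of_nonneg (rpow_nonneg (by positivity : (0 : ℝ) ≤ 1 + ‖y‖) _),
      ← ENNReal.ofReal_mul (mul_nonneg (by positivity) (by positivity))]
    gcongr
    have := rpow_kernel_le_of_far N hR (mem_ball_zero_iff.1 hx) (y := y)
      (by simpa using hy) t
    calc neumannKernel N t (x - y) ≤ cN N * N / 2 * t ^ 2 * ((R ^ 2)⁻¹ *
          ((1 / R + 2) ^ N * (1 + ‖y‖) ^ (-(N : ℝ)))) := by unfold neumannKernel; gcongr
      _ = _ := by ring
  · rw [indicator_of_notMem hy]
    simp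

lemma enorm_sub_neumannKernel_conv_le {N : ℕ} {u h : EuclideanSpace ℝ (Fin N) → ℝ}
    (hu : MemL10 N u) (hc : Continuous h) (hs : HasCompactSupport h) {S : Set _}
    (hS : MeasurableSet S) {t : ℝ} (ht : 0 < t) {x : EuclideanSpace ℝ (Fin N)} (hx : x ∈ S) :
    ‖u x - ∫ y, neumannKernel N t (x - y) * u y‖ₑ ≤ ‖S.indicator u x - h x‖ₑ +
      ‖h x - ∫ y, neumannKernel N t (x - y) * h y‖ₑ +
      (∫⁻ y, ‖neumannKernel N t (x - y)‖ₑ * ‖S.indicator u y - h y‖ₑ) +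
      ∫⁻ y, ‖neumannKernel N t (x - y)‖ₑ * ‖Sᶜ.indicator u y‖ₑ := by
  have hK := continuous_neumannKernel N ht
  have hKu := (hu.integrable_neumannKernel_mul_and_deriv x ht).1
  have hKh : Integrable fun y => neumannKernel N t (x - y) * h y :=
    (by fun_prop : Continuous fun y => neumannKernel N t (x - y) * h y)
      |>.integrable_of_hasCompactSupport hs.mul_left
  have hsplit : ∀ y, u y - h y = (S.indicator u y - h y) + Sᶜ.indicator u y := fun y => by
    rw [← congrFun (indicator_self_add_compl S u) y, Pi.add_apply]; ring
  have heq : u x - ∫ y, neumannKernel N t (x - y) * u y = (S.indicator u x - h x) +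
      (h x - ∫ y, neumannKernel N t (x - y) * h y) +
      -∫ y, neumannKernel N t (x - y) * (u y - h y) := by
    simp_rw [mul_sub]
    rw [integral_sub hKu hKh, indicator_of_mem hx]
    ring
  rw [heq, add_assoc (_ + _) (∫⁻ _, _)]
  refine (enorm_add_le _ _).trans (add_le_add (enorm_add_le _ _) ?_)
  rw [enorm_neg]
  refine (enorm_integral_le_lintegral_enorm _).trans ?_
  have hm : AEMeasurable fun y => ‖neumannKernel N t (x - y)‖ₑ * ‖S.indicator u y - h y‖ₑ :=
    (by fun_prop : Continuous fun y => neumannKernel N t (x - y)).measurable.enorm.aemeasurable.mul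
      ((hu.1.aestronglyMeasurable.aemeasurable.indicator hS).sub hc.aemeasurable).enorm
  rw [← lintegral_add_left' hm]
  refine lintegral_mono fun y => ?_
  rw [enorm_mul, hsplit y, ← mul_add]
  gcongr
  exact enorm_add_le _ _

lemma tendsto_lintegral_sub_neumannKernel_conv {N : ℕ} (hN : 1 ≤ N)
    {u : EuclideanSpace ℝ (Fin N) → ℝ} (hu : MemL10 N u) {R : ℝ} (hR : 0 < R) :
    Tendsto (fun t => ∫⁻ x in ball (0 : EuclideanSpace ℝ (Fin N)) R,
      ‖u x - ∫ y, neumannKernel N t (x - y) * u y‖ₑ) (𝓝[>] 0) (𝓝 0) := by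
  rw [ENNReal.tendsto_nhds_zero]
  intro ε hε
  have hε4 : 0 < ε / 4 := ENNReal.div_pos hε.ne' (by norm_num)
  set S := ball (0 : EuclideanSpace ℝ (Fin N)) (2 * R) with hSdef
  have hS : MeasurableSet S := measurableSet_ball
  have hf : Integrable (S.indicator u) :=
    ((hu.1.integrableOn_isCompact (isCompact_closedBall 0 (2 * R))).mono_set
      ball_subset_closedBall).integrable_indicator hS
  obtain ⟨h, hs, hfh, hc, hhi⟩ := hf.exists_hasCompactSupport_lintegral_sub_le hε4.ne'
  have hfhm : AEMeasurable fun y => ‖S.indicator u y - h y‖ₑ :=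
    (hf.aestronglyMeasurable.aemeasurable.sub hc.aemeasurable).enorm
  have hfar : Tendsto (fun t : ℝ =>
      ENNReal.ofReal (cN N * N / 2 * t ^ 2 * ((R ^ 2)⁻¹ * (1 / R + 2) ^ N)) *
        (∫⁻ y, ‖(1 + ‖y‖) ^ (-(N : ℝ)) * |u y|‖ₑ) *
        volume (ball (0 : EuclideanSpace ℝ (Fin N)) R)) (𝓝[>] 0) (𝓝 0) := by
    have h1 : Tendsto (fun t : ℝ =>
        ENNReal.ofReal (cN N * N / 2 * t ^ 2 * ((R ^ 2)⁻¹ * (1 / R + 2) ^ N)))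
        (𝓝[>] 0) (𝓝 0) := by
      have : Continuous fun t : ℝ =>
        ENNReal.ofReal (cN N * N / 2 * t ^ 2 * ((R ^ 2)⁻¹ * (1 / R + 2) ^ N)) :=
        ENNReal.continuous_ofReal.comp (by fun_prop)
      simpa using (this.tendsto 0).mono_left nhdsWithin_le_nhds
    have h2 := ENNReal.Tendsto.mul_const (b := ∫⁻ y, ‖(1 + ‖y‖) ^ (-(N : ℝ)) * |u y|‖ₑ) h1
      (Or.inr hu.2.hasFiniteIntegral.ne)
    rw [zero_mul] at h2
    have h3 := ENNReal.Tendsto.mul_const (b := volume (ball (0 : EuclideanSpace ℝ (Fin N)) R)) h2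
      (Or.inr measure_ball_lt_top.ne)
    rwa [zero_mul] at h3
  filter_upwards [self_mem_nhdsWithin, ENNReal.tendsto_nhds_zero.1 hfar _ hε4,
    ENNReal.tendsto_nhds_zero.1 (tendsto_lintegral_neumannKernel_conv hN hc hs R) _ hε4]
    with t ht hft hht
  have hK := continuous_neumannKernel N ht
  have hconvm : Measurable fun x => ‖h x - ∫ y, neumannKernel N t (x - y) * h y‖ₑ :=
    (hc.measurable.sub (StronglyMeasurable.integral_prod_right
      (by fun_prop : Continuous (Function.uncurry fun x y =>
        neumannKernel N t (x - y) * h y)).stronglyMeasurable).measurable).enorm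
  calc _ ≤ ∫⁻ x in ball (0 : EuclideanSpace ℝ (Fin N)) R, (‖S.indicator u x - h x‖ₑ +
        ‖h x - ∫ y, neumannKernel N t (x - y) * h y‖ₑ +
        (∫⁻ y, ‖neumannKernel N t (x - y)‖ₑ * ‖S.indicator u y - h y‖ₑ) +
        ENNReal.ofReal (cN N * N / 2 * t ^ 2 * ((R ^ 2)⁻¹ * (1 / R + 2) ^ N)) *
          ∫⁻ y, ‖(1 + ‖y‖) ^ (-(N : ℝ)) * |u y|‖ₑ) := by
        refine setLIntegral_mono' measurableSet_ball fun x hx => ?_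
        refine (enorm_sub_neumannKernel_conv_le hu hc hs hS ht
          (ball_subset_ball (by linarith) hx)).trans ?_
        gcongr
        exact lintegral_neumannKernel_mul_far_le hN u hR hx t
    _ = (∫⁻ x in ball (0 : EuclideanSpace ℝ (Fin N)) R, ‖S.indicator u x - h x‖ₑ) +
        (∫⁻ x in ball (0 : EuclideanSpace ℝ (Fin N)) R,
          ‖h x - ∫ y, neumannKernel N t (x - y) * h y‖ₑ) +
        (∫⁻ x in ball (0 : EuclideanSpace ℝ (Fin N)) R,
          ∫⁻ y, ‖neumannKernel N t (x - y)‖ₑ * ‖S.indicator u y - h y‖ₑ) +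
        ENNReal.ofReal (cN N * N / 2 * t ^ 2 * ((R ^ 2)⁻¹ * (1 / R + 2) ^ N)) *
          (∫⁻ y, ‖(1 + ‖y‖) ^ (-(N : ℝ)) * |u y|‖ₑ) *
          volume (ball (0 : EuclideanSpace ℝ (Fin N)) R) := by
        rw [lintegral_add_right _ measurable_const, lintegral_const,
          Measure.restrict_apply_univ, lintegral_add_left', lintegral_add_right _ hconvm]
        exact hfhm.restrict.add hconvm.aemeasurable
    _ ≤ ε / 4 + ε / 4 + ε / 4 + ε / 4 := by
        gcongr
        · exact (setLIntegral_le_lintegral _ _).trans hfh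
        · exact (setLIntegral_le_lintegral _ _).trans
            ((lintegral_neumannKernel_conv hN ht hfhm).trans_le hfh)
    _ = ε := by
        rw [show ε / 4 + ε / 4 + ε / 4 + ε / 4 = 4 * (ε / 4) by ring]
        exact ENNReal.mul_div_cancel (by norm_num) (by norm_num)

/-- the extension `w_u` attains `u` as inhomogeneous Neumann datum in
`L^1_loc`: for every `R > 0`, `∫_{B_R} |t ∂_t w_u(x,t) + u(x)| dx → 0` as `t → 0⁺`. -/
theorem stmt1 (N : ℕ) (hN : 1 ≤ N) (u : EuclideanSpace ℝ (Fin N) → ℝ)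
    (hu : MemL10 N u) :
    ∀ R : ℝ, 0 < R →
      Tendsto (fun t : ℝ =>
          ∫ x in Metric.ball (0 : EuclideanSpace ℝ (Fin N)) R,
            |t * deriv (fun τ : ℝ => poissonExt N u x τ) t + u x|)
        (𝓝[>] (0 : ℝ)) (𝓝 0) := by
  intro R hR
  rw [tendsto_zero_iff_enorm_tendsto_zero]
  refine tendsto_of_tendsto_of_tendsto_of_le_of_le' tendsto_const_nhds
    (tendsto_lintegral_sub_neumannKernel_conv hN hu hR) (.of_forall fun _ => zero_le) ?_
  filter_upwards [self_mem_nhdsWithin] with t ht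
  refine (enorm_integral_le_lintegral_enorm _).trans (lintegral_mono fun x => ?_)
  rw [(hu.integrable_neumannKernel_mul_and_deriv x ht).2, enorm_abs, neg_add_eq_sub]
end
end

section
/- Let N ≥ 1 be an integer and let u ∈ L^1_0(ℝ^N). Then for every R > 0, lim_{t→0⁺} ∫_{B_R(0)} | w_u(x,t)/ln t + u(x) | dx = 0; that is, w_u(·,t)/ln t → −u in L^1_loc(ℝ^N) as t → 0⁺. -/
open MeasureTheory Real Filter Topology Set Metric

noncomputable section

lemma rpow_neg_natCast_div_two {a : ℝ} (ha : 0 ≤ a) (N : ℕ) :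
    a ^ (-(N : ℝ) / 2) = ((√a) ^ N)⁻¹ := by
  rw [Real.sqrt_eq_rpow, ← Real.rpow_natCast, ← Real.rpow_mul ha, ← Real.rpow_neg ha]
  congr 1
  ring

lemma radial_kernel_nonneg {N : ℕ} {r t : ℝ} (hr : 0 ≤ r) :
    0 ≤ r ^ (N - 1) * (r ^ 2 + t ^ 2) ^ (-(N : ℝ) / 2) := by positivity

lemma radial_kernel_le {N : ℕ} (hN : 1 ≤ N) {r t : ℝ} (hr : 0 ≤ r) (ht : 0 < t) :
    r ^ (N - 1) * (r ^ 2 + t ^ 2) ^ (-(N : ℝ) / 2) ≤ (√(r ^ 2 + t ^ 2))⁻¹ := by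
  rw [rpow_neg_natCast_div_two (by positivity)]
  obtain ⟨n, rfl⟩ : ∃ n, N = n + 1 := ⟨N - 1, by omega⟩
  have hs : 0 < √(r ^ 2 + t ^ 2) := by positivity
  have hrs : r ≤ √(r ^ 2 + t ^ 2) := Real.le_sqrt_of_sq_le (by nlinarith)
  rw [Nat.add_sub_cancel, pow_succ, mul_inv, ← mul_assoc]
  refine mul_le_of_le_one_left (by positivity) ?_
  rw [← div_eq_mul_inv, div_le_one (by positivity)]
  gcongr

lemma le_radial_kernel {N : ℕ} (hN : 1 ≤ N) {r t : ℝ} (hr : 0 < r) (ht : 0 < t) :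
    r⁻¹ - N * t ^ 2 * r ^ (-3 : ℤ) ≤ r ^ (N - 1) * (r ^ 2 + t ^ 2) ^ (-(N : ℝ) / 2) := by
  rw [rpow_neg_natCast_div_two (by positivity)]
  set s := √(r ^ 2 + t ^ 2) with hs_def
  have hs : 0 < s := by positivity
  have hs2 : s ^ 2 = r ^ 2 + t ^ 2 := Real.sq_sqrt (by positivity)
  have hrs : r ≤ s := Real.le_sqrt_of_sq_le (by nlinarith)
  have hB := one_add_mul_le_pow (a := r / s - 1)
    (by have : 0 ≤ r / s := by positivity
        linarith) N
  have hq : 1 - r / s ≤ t ^ 2 / r ^ 2 := by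
    rw [one_sub_div hs.ne', div_le_div_iff₀ hs (by positivity)]
    have h1 : t ^ 2 = (s - r) * (s + r) := by linarith [hs2]
    rw [h1, mul_assoc]
    exact mul_le_mul_of_nonneg_left (by nlinarith) (by linarith)
  have hkey : r ^ (N - 1) * (s ^ N)⁻¹ = r⁻¹ * (r / s) ^ N := by
    obtain ⟨n, rfl⟩ : ∃ n, N = n + 1 := ⟨N - 1, by omega⟩
    simp only [Nat.add_sub_cancel, div_pow, pow_succ r n]
    field_simp
  have hl : r⁻¹ - N * t ^ 2 * r ^ (-3 : ℤ) = r⁻¹ * (1 - N * (t ^ 2 / r ^ 2)) := by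
    simp only [zpow_neg]
    norm_cast
    field_simp
  rw [hkey, hl]
  refine mul_le_mul_of_nonneg_left ?_ (by positivity)
  have := mul_le_mul_of_nonneg_left hq (Nat.cast_nonneg N : (0 : ℝ) ≤ N)
  rw [add_sub_cancel] at hB
  linarith

lemma abs_integral_radial_kernel_add_log_le {N : ℕ} (hN : 1 ≤ N) {t : ℝ} (ht : 0 < t)
    (ht1 : t < 1) :
    |(∫ r in (0 : ℝ)..1, r ^ (N - 1) * (r ^ 2 + t ^ 2) ^ (-(N : ℝ) / 2)) + Real.log t|
      ≤ 1 + N := by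
  have hcont : Continuous fun r : ℝ => r ^ (N - 1) * (r ^ 2 + t ^ 2) ^ (-(N : ℝ) / 2) := by
    refine (continuous_pow _).mul (Continuous.rpow_const (by fun_prop) fun r => Or.inl ?_)
    positivity
  have hint := fun a b => hcont.intervalIntegrable (μ := volume) a b
  rw [← intervalIntegral.integral_add_adjacent_intervals (hint 0 t) (hint t 1)]
  have h0 : 0 ≤ ∫ r in (0 : ℝ)..t, r ^ (N - 1) * (r ^ 2 + t ^ 2) ^ (-(N : ℝ) / 2) :=
    intervalIntegral.integral_nonneg ht.le fun r hr => radial_kernel_nonneg hr.1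
  have h1 : ∫ r in (0 : ℝ)..t, r ^ (N - 1) * (r ^ 2 + t ^ 2) ^ (-(N : ℝ) / 2) ≤ 1 := by
    calc _ ≤ ∫ r in (0 : ℝ)..t, t⁻¹ := by
          refine intervalIntegral.integral_mono_on ht.le (hint _ _) (by simp) fun r hr => ?_
          refine (radial_kernel_le hN hr.1 ht).trans ?_
          gcongr
          exact Real.le_sqrt_of_sq_le (by nlinarith [sq_nonneg r])
      _ = 1 := by simp [ht.ne']
  have hnot : (0 : ℝ) ∉ Set.uIcc t 1 := by
    rw [Set.uIcc_of_le ht1.le]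
    exact fun h => absurd h.1 (by linarith)
  have hinv : IntervalIntegrable (fun r : ℝ => r⁻¹) volume t 1 :=
    intervalIntegral.intervalIntegrable_inv (fun r hr h => hnot (h ▸ hr)) continuousOn_id
  have hz : IntervalIntegrable (fun r : ℝ => r ^ (-3 : ℤ)) volume t 1 :=
    intervalIntegral.intervalIntegrable_zpow (Or.inr hnot)
  have hlog : ∫ r in t..1, r⁻¹ = -Real.log t := by
    rw [integral_inv hnot, one_div, Real.log_inv]
  have h2 : ∫ r in t..1, r ^ (N - 1) * (r ^ 2 + t ^ 2) ^ (-(N : ℝ) / 2) ≤ -Real.log t := by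
    rw [← hlog]
    refine intervalIntegral.integral_mono_on ht1.le (hint _ _) hinv fun r hr => ?_
    have hr0 : 0 < r := ht.trans_le hr.1
    refine (radial_kernel_le hN hr0.le ht).trans ?_
    gcongr
    exact Real.le_sqrt_of_sq_le (by nlinarith [sq_nonneg t])
  have h3 : -Real.log t - N ≤
      ∫ r in t..1, r ^ (N - 1) * (r ^ 2 + t ^ 2) ^ (-(N : ℝ) / 2) := by
    calc -Real.log t - N ≤ ∫ r in t..1, (r⁻¹ - N * t ^ 2 * r ^ (-3 : ℤ)) := by
          rw [intervalIntegral.integral_sub hinv (hz.const_mul _),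
            intervalIntegral.integral_const_mul, hlog,
            integral_zpow (Or.inr ⟨by norm_num, hnot⟩)]
          have he : t ^ 2 * ((1 ^ (-3 + 1 : ℤ) - t ^ (-3 + 1 : ℤ)) / ((-3 : ℤ) + 1)) ≤ 1 := by
            have : t ^ (-3 + 1 : ℤ) = (t ^ 2)⁻¹ := by
              norm_num [zpow_neg]
            rw [this]
            norm_num
            field_simp
            nlinarith
          rw [mul_assoc]
          have := mul_le_mul_of_nonneg_left he (Nat.cast_nonneg N : (0 : ℝ) ≤ N)
          linarith
      _ ≤ _ := by
          refine intervalIntegral.integral_mono_on ht1.le (hinv.sub (hz.const_mul _))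
            (hint _ _) fun r hr => le_radial_kernel hN (ht.trans_le hr.1) ht
  have hN0 : (0 : ℝ) ≤ N := Nat.cast_nonneg N
  rw [abs_le]
  constructor <;> linarith

lemma cN_mul_volume_ball {N : ℕ} (hN : 1 ≤ N) :
    cN N / 2 * (N * (volume : Measure (EuclideanSpace ℝ (Fin N))).real (ball 0 1)) = 1 := by
  have : Nonempty (Fin N) := ⟨⟨0, by omega⟩⟩
  have hN0 : (0 : ℝ) < N := by exact_mod_cast hN
  have hG : 0 < Real.Gamma ((N : ℝ) / 2) := Real.Gamma_pos_of_pos (by positivity)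
  rw [Measure.real, EuclideanSpace.volume_ball, Fintype.card_fin,
    Real.Gamma_add_one (by positivity)]
  simp only [ENNReal.ofReal_one, one_pow, one_mul]
  rw [ENNReal.toReal_ofReal (by positivity), cN, Real.sqrt_eq_rpow, ← Real.rpow_natCast,
    ← Real.rpow_mul Real.pi_pos.le, one_div_mul_eq_div]
  have : 0 < Real.pi ^ ((N : ℝ) / 2) := by positivity
  field_simp

/-- The Poisson-type kernel truncated to the unit ball. -/
def truncKernel (N : ℕ) (t : ℝ) : EuclideanSpace ℝ (Fin N) → ℝ :=
  (ball 0 1).indicator fun z => cN N / 2 * (‖z‖ ^ 2 + t ^ 2) ^ (-(N : ℝ) / 2)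

lemma abs_integral_truncKernel_add_log_le {N : ℕ} (hN : 1 ≤ N) {t : ℝ} (ht : 0 < t)
    (ht1 : t < 1) : |(∫ z, truncKernel N t z) + Real.log t| ≤ 1 + N := by
  have : Nonempty (Fin N) := ⟨⟨0, by omega⟩⟩
  have hrad : ∀ z : EuclideanSpace ℝ (Fin N), truncKernel N t z =
      (Iio (1 : ℝ)).indicator (fun r => cN N / 2 * (r ^ 2 + t ^ 2) ^ (-(N : ℝ) / 2)) ‖z‖ := by
    intro z
    simp [truncKernel, Set.indicator]
  have : ∫ z, truncKernel N t z =
      ∫ r in (0 : ℝ)..1, r ^ (N - 1) * (r ^ 2 + t ^ 2) ^ (-(N : ℝ) / 2) := by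
    simp_rw [hrad]
    rw [integral_fun_norm_addHaar, finrank_euclideanSpace_fin]
    simp_rw [smul_eq_mul, nsmul_eq_mul, ← Set.indicator_mul_right _ (fun r : ℝ => r ^ (N - 1))]
    rw [setIntegral_indicator measurableSet_Iio, Ioi_inter_Iio,
      intervalIntegral.integral_of_le zero_le_one, ← integral_Ioc_eq_integral_Ioo]
    simp_rw [mul_left_comm _ (cN N / 2)]
    rw [integral_const_mul, ← mul_assoc, ← mul_assoc, mul_comm _ (cN N / 2),
      cN_mul_volume_ball hN, one_mul]
  rw [this]
  exact abs_integral_radial_kernel_add_log_le hN ht ht1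

lemma truncKernel_nonneg {N : ℕ} (hN : 1 ≤ N) (t : ℝ) (z : EuclideanSpace ℝ (Fin N)) :
    0 ≤ truncKernel N t z := by
  have := cN_pos hN
  exact Set.indicator_nonneg (fun z _ => by positivity) z

lemma aestronglyMeasurable_truncKernel (N : ℕ) (t : ℝ) :
    AEStronglyMeasurable (truncKernel N t) volume := by
  refine (Measurable.indicator ?_ measurableSet_ball).aestronglyMeasurable
  fun_prop

lemma rpow_kernel_le {N : ℕ} {d r t : ℝ} (hd : 0 < d) (hdr : d ≤ √(r ^ 2 + t ^ 2)) :
    (r ^ 2 + t ^ 2) ^ (-(N : ℝ) / 2) ≤ (d ^ N)⁻¹ := by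
  rw [rpow_neg_natCast_div_two (by positivity)]
  gcongr

lemma truncKernel_le {N : ℕ} (hN : 1 ≤ N) {t d : ℝ} (hd : 0 < d)
    {z : EuclideanSpace ℝ (Fin N)} (hz : d ≤ √(‖z‖ ^ 2 + t ^ 2)) :
    truncKernel N t z ≤ (ball 0 1).indicator (fun _ => cN N / 2 * (d ^ N)⁻¹) z := by
  have := cN_pos hN
  refine Set.indicator_le_indicator' fun _ => ?_
  gcongr
  exact rpow_kernel_le hd hz

lemma norm_truncKernel_le {N : ℕ} (hN : 1 ≤ N) {t : ℝ} (ht : 0 < t)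
    (z : EuclideanSpace ℝ (Fin N)) : ‖truncKernel N t z‖ ≤ cN N / 2 * (t ^ N)⁻¹ := by
  have := cN_pos hN
  rw [Real.norm_of_nonneg (truncKernel_nonneg hN t z)]
  refine (truncKernel_le hN ht (Real.le_sqrt_of_sq_le (by nlinarith [sq_nonneg ‖z‖]))).trans ?_
  exact Set.indicator_le_self' (fun _ _ => by positivity) z

lemma integrable_truncKernel {N : ℕ} (hN : 1 ≤ N) {t : ℝ} (ht : 0 < t) :
    Integrable (truncKernel N t) volume := by
  refine Integrable.mono' (g := (ball 0 1).indicator fun _ => cN N / 2 * (t ^ N)⁻¹)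
    ((integrable_indicator_iff measurableSet_ball).2 (integrableOn_const measure_ball_lt_top.ne))
    (aestronglyMeasurable_truncKernel N t) (Eventually.of_forall fun z => ?_)
  rw [Real.norm_of_nonneg (truncKernel_nonneg hN t z)]
  exact truncKernel_le hN ht (Real.le_sqrt_of_sq_le (by nlinarith [sq_nonneg ‖z‖]))

lemma tendsto_integral_abs_translate_sub {N : ℕ} {v : EuclideanSpace ℝ (Fin N) → ℝ}
    (hv : Integrable v volume) :
    Tendsto (fun z => ∫ x, |v (x - z) - v x|) (𝓝 0) (𝓝 0) := by
  have hm : MemLp v 1 volume := memLp_one_iff_integrable.2 hv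
  have : Fact ((1 : ENNReal) ≠ ⊤) := ⟨ENNReal.one_ne_top⟩
  have hc : Continuous fun z : EuclideanSpace ℝ (Fin N) =>
      ‖(DomAddAct.mk (-z) +ᵥ hm.toLp v) - hm.toLp v‖ := by
    have h1 : Continuous fun z : EuclideanSpace ℝ (Fin N) => DomAddAct.mk (-z) :=
      DomAddAct.mkHomeomorph.continuous.comp continuous_neg
    exact ((h1.vadd continuous_const).sub continuous_const).norm
  have h := hc.tendsto 0
  have e : ∀ z : EuclideanSpace ℝ (Fin N),
      ‖(DomAddAct.mk (-z) +ᵥ hm.toLp v) - hm.toLp v‖ = ∫ x, |v (x - z) - v x| := by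
    intro z
    rw [DomAddAct.mk_vadd_toLp, ← MemLp.toLp_sub, L1.norm_eq_integral_norm]
    refine integral_congr_ae ?_
    filter_upwards [MemLp.coeFn_toLp ((hm.comp_measurePreserving
      (measurePreserving_vadd (-z) volume)).sub hm)] with x hx
    refine (congrArg norm hx).trans ?_
    simp [Real.norm_eq_abs, sub_eq_neg_add]
  simp_rw [e] at h
  simpa using h

lemma integrable_abs_translate_sub_mul_truncKernel {N : ℕ} (hN : 1 ≤ N)
    {v : EuclideanSpace ℝ (Fin N) → ℝ} (hv : Integrable v volume) {t : ℝ} (ht : 0 < t) :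
    Integrable (fun p : EuclideanSpace ℝ (Fin N) × EuclideanSpace ℝ (Fin N) =>
      |v (p.1 - p.2) - v p.1| * truncKernel N t p.2) (volume.prod volume) := by
  have hK := integrable_truncKernel hN ht
  have h := ((hK.convolution_integrand (ContinuousLinearMap.mul ℝ ℝ) hv).sub
    (hv.mul_prod hK)).norm
  refine h.congr (Eventually.of_forall fun p => ?_)
  simp only [Pi.sub_apply, ContinuousLinearMap.mul_apply', Real.norm_eq_abs]
  rw [mul_comm (truncKernel N t p.2), ← sub_mul, abs_mul,
    abs_of_nonneg (truncKernel_nonneg hN t p.2)]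

lemma integral_abs_translate_sub_le {N : ℕ} {v : EuclideanSpace ℝ (Fin N) → ℝ}
    (hv : Integrable v volume) (z : EuclideanSpace ℝ (Fin N)) :
    ∫ x, |v (x - z) - v x| ≤ 2 * ∫ x, |v x| := by
  have hvz : Integrable (fun x => v (x - z)) volume := hv.comp_sub_right z
  calc ∫ x, |v (x - z) - v x| ≤ ∫ x, (|v (x - z)| + |v x|) :=
        integral_mono (hvz.sub hv).abs (hvz.abs.add hv.abs) fun x => abs_sub _ _
    _ = 2 * ∫ x, |v x| := by
        rw [integral_add hvz.abs hv.abs, integral_sub_right_eq_self (fun x => |v x|) z, two_mul]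

lemma exists_integral_truncKernel_translate_le {N : ℕ} (hN : 1 ≤ N)
    {v : EuclideanSpace ℝ (Fin N) → ℝ} (hv : Integrable v volume) {ε : ℝ} (hε : 0 < ε) :
    ∃ C : ℝ, ∀ t : ℝ, 0 < t →
      ∫ x, ∫ z, |v (x - z) - v x| * truncKernel N t z ≤ ε * (∫ z, truncKernel N t z) + C := by
  obtain ⟨δ, hδ, hδε⟩ := Metric.eventually_nhds_iff_ball.1
    ((tendsto_integral_abs_translate_sub hv).eventually_le_const hε)
  have hc := cN_pos hN
  have hv0 : 0 ≤ ∫ x, |v x| := integral_nonneg fun x => abs_nonneg _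
  set B : EuclideanSpace ℝ (Fin N) → ℝ :=
    (ball 0 1).indicator fun _ => cN N / 2 * (δ ^ N)⁻¹
  have hBi : Integrable B volume :=
    (integrable_indicator_iff measurableSet_ball).2 (integrableOn_const measure_ball_lt_top.ne)
  refine ⟨∫ z, 2 * (∫ x, |v x|) * B z, fun t ht => ?_⟩
  have hK := integrable_truncKernel hN ht
  have hint := integrable_abs_translate_sub_mul_truncKernel hN hv ht
  rw [integral_integral_swap hint, ← integral_const_mul,
    ← integral_add (hK.const_mul _) (hBi.const_mul _)]
  refine integral_mono hint.integral_prod_right ((hK.const_mul _).add (hBi.const_mul _))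
    fun z => ?_
  have hKz := truncKernel_nonneg hN t z
  have hBz : 0 ≤ B z := Set.indicator_nonneg (fun _ _ => by positivity) z
  simp only [integral_mul_const]
  by_cases hz : z ∈ ball 0 δ
  · exact (mul_le_mul_of_nonneg_right (hδε z hz) hKz).trans
      (le_add_of_nonneg_right (by positivity))
  · have hz' : δ ≤ ‖z‖ := by simpa using hz
    refine (mul_le_mul (integral_abs_translate_sub_le hv z) (truncKernel_le hN hδ ?_) hKz
      (by positivity)).trans (le_add_of_nonneg_left (by positivity))
    exact Real.le_sqrt_of_sq_le (by nlinarith [sq_nonneg t])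

lemma abs_kernel_far_le {N : ℕ} (hN : 1 ≤ N) {R t a : ℝ} (hR : 0 < R)
    {x y : EuclideanSpace ℝ (Fin N)} (hx : x ∈ ball 0 R) (hxy : 1 ≤ ‖x - y‖) :
    |a * (cN N / 2 * (‖x - y‖ ^ 2 + t ^ 2) ^ (-(N : ℝ) / 2))| ≤
      cN N / 2 * (2 + R) ^ N * ((1 + ‖y‖) ^ (-(N : ℝ)) * |a|) := by
  have hc := cN_pos hN
  have hx' : ‖x‖ < R := by simpa using hx
  have hy : ‖y‖ ≤ ‖x‖ + ‖x - y‖ := by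
    have := norm_sub_le x (x - y)
    rwa [sub_sub_cancel] at this
  have hd : (1 + ‖y‖) / (2 + R) ≤ ‖x - y‖ := by
    rw [div_le_iff₀ (by positivity)]
    nlinarith
  have hk := rpow_kernel_le (N := N) (d := (1 + ‖y‖) / (2 + R)) (r := ‖x - y‖) (t := t)
    (by positivity)
    (hd.trans (Real.le_sqrt_of_sq_le (by nlinarith [sq_nonneg t])))
  rw [abs_mul, abs_of_nonneg (a := cN N / 2 * _) (by positivity), Real.rpow_neg (by positivity),
    Real.rpow_natCast]
  calc |a| * (cN N / 2 * (‖x - y‖ ^ 2 + t ^ 2) ^ (-(N : ℝ) / 2))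
      ≤ |a| * (cN N / 2 * (((1 + ‖y‖) / (2 + R)) ^ N)⁻¹) := by gcongr
    _ = _ := by
        rw [div_pow, inv_div]
        ring

lemma abs_poissonExt_add_log_mul_le {N : ℕ} (hN : 1 ≤ N) {u : EuclideanSpace ℝ (Fin N) → ℝ}
    (hu : MemL10 N u) {R t : ℝ} (hR : 0 < R) (ht : 0 < t) (ht1 : t < 1)
    (hv : Integrable ((ball 0 (R + 1)).indicator u) volume)
    {x : EuclideanSpace ℝ (Fin N)} (hx : x ∈ ball 0 R) :
    |poissonExt N u x t + Real.log t * u x| ≤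
      (∫ z, |(ball 0 (R + 1)).indicator u (x - z) - (ball 0 (R + 1)).indicator u x| *
          truncKernel N t z) +
        (1 + N) * |(ball 0 (R + 1)).indicator u x| +
        cN N / 2 * (2 + R) ^ N * ∫ y, (1 + ‖y‖) ^ (-(N : ℝ)) * |u y| := by
  have hc := cN_pos hN
  have hx' : ‖x‖ < R := by simpa using hx
  have hvx : (ball 0 (R + 1)).indicator u x = u x :=
    Set.indicator_of_mem (ball_subset_ball (by linarith) hx) u
  set v := (ball 0 (R + 1)).indicator u
  have hK := integrable_truncKernel hN ht
  have hvK : Integrable (fun z => v (x - z) * truncKernel N t z) volume :=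
    (hv.comp_sub_left x).mul_bdd (aestronglyMeasurable_truncKernel N t)
      (Eventually.of_forall (norm_truncKernel_le hN ht))
  have hF1 : Integrable (fun y => v y * truncKernel N t (x - y)) volume := by
    simpa using hvK.comp_sub_left x
  have hF1_eq : ∫ y, v y * truncKernel N t (x - y) = ∫ z, v (x - z) * truncKernel N t z := by
    rw [← integral_sub_left_eq_self _ volume x]
    simp
  set F : EuclideanSpace ℝ (Fin N) → ℝ :=
    fun y => u y * (cN N / 2 * (‖x - y‖ ^ 2 + t ^ 2) ^ (-(N : ℝ) / 2)) with hF
  have hbound : ∀ y, |F y - v y * truncKernel N t (x - y)| ≤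
      cN N / 2 * (2 + R) ^ N * ((1 + ‖y‖) ^ (-(N : ℝ)) * |u y|) := by
    intro y
    by_cases hy : ‖x - y‖ < 1
    · have h1 : v y = u y := by
        refine Set.indicator_of_mem ?_ u
        have := norm_sub_le x (x - y)
        rw [sub_sub_cancel] at this
        rw [mem_ball_zero_iff]
        linarith
      have h2 : truncKernel N t (x - y) =
          cN N / 2 * (‖x - y‖ ^ 2 + t ^ 2) ^ (-(N : ℝ) / 2) :=
        Set.indicator_of_mem (by simpa using hy) _
      rw [h1, h2, hF, sub_self, abs_zero]
      positivity
    · have h2 : truncKernel N t (x - y) = 0 :=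
        Set.indicator_of_notMem (by simpa using hy) _
      rw [h2, mul_zero, sub_zero]
      exact abs_kernel_far_le hN hR hx (not_lt.1 hy)
  have hF_meas : AEStronglyMeasurable F volume := by
    refine hu.1.aestronglyMeasurable.mul (Measurable.aestronglyMeasurable ?_)
    fun_prop
  have hF2 : Integrable (fun y => F y - v y * truncKernel N t (x - y)) volume :=
    (hu.2.const_mul _).mono' (hF_meas.sub hF1.aestronglyMeasurable)
      (Eventually.of_forall hbound)
  have hw : poissonExt N u x t = (∫ y, (F y - v y * truncKernel N t (x - y))) +
      ∫ z, v (x - z) * truncKernel N t z := by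
    rw [← hF1_eq, ← integral_add hF2 hF1, poissonExt, ← integral_const_mul]
    refine integral_congr_ae (Eventually.of_forall fun y => ?_)
    simp only [hF]
    ring
  have hfar : |∫ y, (F y - v y * truncKernel N t (x - y))| ≤
      cN N / 2 * (2 + R) ^ N * ∫ y, (1 + ‖y‖) ^ (-(N : ℝ)) * |u y| := by
    rw [← integral_const_mul]
    exact norm_integral_le_of_norm_le
      (f := fun y => F y - v y * truncKernel N t (x - y)) (hu.2.const_mul _)
      (Eventually.of_forall hbound)
  have hnear : |∫ z, (v (x - z) - v x) * truncKernel N t z| ≤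
      ∫ z, |v (x - z) - v x| * truncKernel N t z := by
    refine (abs_integral_le_integral_abs).trans_eq (integral_congr_ae
      (Eventually.of_forall fun z => ?_))
    simp only [abs_mul, abs_of_nonneg (truncKernel_nonneg hN t z)]
  have hnear_eq : ∫ z, (v (x - z) - v x) * truncKernel N t z =
      (∫ z, v (x - z) * truncKernel N t z) - v x * ∫ z, truncKernel N t z := by
    rw [← integral_const_mul, ← integral_sub hvK (hK.const_mul _)]
    simp_rw [sub_mul]
  have hmass : |((∫ z, truncKernel N t z) + Real.log t) * v x| ≤ (1 + N) * |v x| := by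
    rw [abs_mul]
    gcongr
    exact abs_integral_truncKernel_add_log_le hN ht ht1
  have hsplit : poissonExt N u x t + Real.log t * u x =
      (∫ z, (v (x - z) - v x) * truncKernel N t z) +
        ((∫ z, truncKernel N t z) + Real.log t) * v x +
        ∫ y, (F y - v y * truncKernel N t (x - y)) := by
    rw [hw, hnear_eq, ← hvx]
    ring
  rw [hsplit]
  exact (abs_add_three _ _ _).trans (add_le_add_three hnear hmass hfar)

lemma exists_integral_abs_poissonExt_div_log_add_le {N : ℕ} (hN : 1 ≤ N)
    {u : EuclideanSpace ℝ (Fin N) → ℝ} (hu : MemL10 N u) {R ε : ℝ} (hR : 0 < R) (hε : 0 < ε) :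
    ∃ C : ℝ, ∀ t : ℝ, 0 < t → t < 1 →
      ∫ x in ball (0 : EuclideanSpace ℝ (Fin N)) R, |poissonExt N u x t / Real.log t + u x| ≤
        ε + C / -Real.log t := by
  have hv : Integrable ((ball 0 (R + 1)).indicator u) volume :=
    (integrable_indicator_iff measurableSet_ball).2
      ((hu.1.integrableOn_isCompact (isCompact_closedBall 0 (R + 1))).mono_set
        ball_subset_closedBall)
  obtain ⟨C, hC⟩ := exists_integral_truncKernel_translate_le hN hv hε
  set v := (ball 0 (R + 1)).indicator u
  set A : ℝ := cN N / 2 * (2 + R) ^ N * ∫ y, (1 + ‖y‖) ^ (-(N : ℝ)) * |u y|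
  refine ⟨ε * (1 + N) + C + (1 + N) * (∫ x, |v x|) +
    (volume : Measure (EuclideanSpace ℝ (Fin N))).real (ball 0 R) * A, fun t ht ht1 => ?_⟩
  have hlog : Real.log t < 0 := Real.log_neg ht ht1
  have hL : 0 < -Real.log t := by linarith
  set G : EuclideanSpace ℝ (Fin N) → ℝ :=
    fun x => ∫ z, |v (x - z) - v x| * truncKernel N t z
  have hGi : Integrable G volume :=
    (integrable_abs_translate_sub_mul_truncKernel hN hv ht).integral_prod_left
  have hG0 : ∀ x, 0 ≤ G x := fun x =>
    integral_nonneg fun z => mul_nonneg (abs_nonneg _) (truncKernel_nonneg hN t z)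
  have hGv : Integrable (fun x => G x + (1 + N) * |v x|) volume := hGi.add (hv.abs.const_mul _)
  have hconst : IntegrableOn (fun _ : EuclideanSpace ℝ (Fin N) => A) (ball 0 R) volume :=
    integrableOn_const measure_ball_lt_top.ne
  have hsum : IntegrableOn (fun x => G x + (1 + N) * |v x| + A) (ball 0 R) volume :=
    hGv.integrableOn.add hconst
  have hmass := (abs_le.1 (abs_integral_truncKernel_add_log_le hN ht ht1)).2
  calc ∫ x in ball (0 : EuclideanSpace ℝ (Fin N)) R, |poissonExt N u x t / Real.log t + u x|
      ≤ ∫ x in ball (0 : EuclideanSpace ℝ (Fin N)) R,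
          (G x + (1 + N) * |v x| + A) / -Real.log t := by
        refine integral_mono_of_nonneg (Eventually.of_forall fun x => abs_nonneg _)
          (hsum.div_const _) ?_
        filter_upwards [ae_restrict_mem measurableSet_ball] with x hx
        rw [le_div_iff₀ hL, ← abs_of_neg hlog, ← abs_mul, add_mul,
          div_mul_cancel₀ _ hlog.ne, mul_comm (u x)]
        exact abs_poissonExt_add_log_mul_le hN hu hR ht ht1 hv hx
    _ = ((∫ x in ball 0 R, (G x + (1 + N) * |v x|)) +
          (volume : Measure (EuclideanSpace ℝ (Fin N))).real (ball 0 R) * A) /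
            -Real.log t := by
        rw [integral_div, integral_add hGv.integrableOn hconst, setIntegral_const, smul_eq_mul]
    _ ≤ ((ε * (∫ z, truncKernel N t z) + C + (1 + N) * (∫ x, |v x|)) +
          (volume : Measure (EuclideanSpace ℝ (Fin N))).real (ball 0 R) * A) /
            -Real.log t := by
        gcongr
        refine (setIntegral_le_integral hGv (Eventually.of_forall fun x =>
          add_nonneg (hG0 x) (by positivity))).trans ?_
        rw [integral_add hGi (hv.abs.const_mul _), integral_const_mul]
        gcongr
        exact hC t ht
    _ ≤ _ := by
        rw [div_le_iff₀ hL, add_mul ε, div_mul_cancel₀ _ hL.ne']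
        nlinarith

/-- `w_u(·,t)/ln t → −u` in `L^1_loc(ℝ^N)` as `t → 0⁺`. -/
theorem stmt2 (N : ℕ) (hN : 1 ≤ N) (u : EuclideanSpace ℝ (Fin N) → ℝ)
    (hu : MemL10 N u) :
    ∀ R : ℝ, 0 < R →
      Tendsto (fun t : ℝ =>
          ∫ x in Metric.ball (0 : EuclideanSpace ℝ (Fin N)) R,
            |poissonExt N u x t / Real.log t + u x|)
        (𝓝[>] (0 : ℝ)) (𝓝 0) := by
  intro R hR
  refine tendsto_order.2 ⟨fun a ha => Eventually.of_forall fun t =>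
    ha.trans_le (integral_nonneg fun x => abs_nonneg _), fun ε hε => ?_⟩
  obtain ⟨C, hC⟩ := exists_integral_abs_poissonExt_div_log_add_le hN hu hR (half_pos hε)
  have hlim : Tendsto (fun t : ℝ => C / -Real.log t) (𝓝[>] (0 : ℝ)) (𝓝 0) :=
    Tendsto.const_div_atTop (tendsto_neg_atBot_atTop.comp Real.tendsto_log_nhdsGT_zero) C
  filter_upwards [hlim.eventually_lt_const (half_pos hε), Ioo_mem_nhdsGT one_pos] with t ht ht01
  exact (hC t ht01.1 ht01.2).trans_lt (by linarith)
end
end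

section
/- Let N ≥ 1 be an integer, let u ∈ L^1_loc(ℝ^N), and let w ∈ C¹(ℝ^N × (0,∞)) belong to 𝒜𝒢(ℝ^N × (0,∞)) and satisfy, for every R > 0, lim_{t→0⁺} ∫_{B_R(0)} | t ∂_t w(x,t) + u(x) | dx = 0. Then also, for every R > 0, lim_{t→0⁺} ∫_{B_R(0)} | w(x,t)/ln t + u(x) | dx = 0. -/
open MeasureTheory Real Filter Topology Set Metric

noncomputable section

/-- The derivative in the last variable of a `C¹` function on the half-space is continuous. -/
theorem continuousOn_deriv_snd {E : Type*} [NormedAddCommGroup E] [NormedSpace ℝ E]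
    {w : E × ℝ → ℝ} (hC1 : ContDiffOn ℝ 1 w {p : E × ℝ | 0 < p.2}) :
    ContinuousOn (fun p : E × ℝ => deriv (fun τ : ℝ => w (p.1, τ)) p.2) {p | 0 < p.2} ∧
      ∀ x : E, ∀ t : ℝ, 0 < t →
        HasDerivAt (fun τ : ℝ => w (x, τ)) (deriv (fun τ : ℝ => w (x, τ)) t) t := by
  have ho : IsOpen {p : E × ℝ | 0 < p.2} := isOpen_lt continuous_const continuous_snd
  have hd : ∀ x : E, ∀ t : ℝ, 0 < t →
      HasDerivAt (fun τ : ℝ => w (x, τ)) (fderiv ℝ w (x, t) (0, 1)) t := by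
    intro x t ht
    have h1 : HasFDerivAt w (fderiv ℝ w (x, t)) (x, t) :=
      ((hC1.differentiableOn one_ne_zero).differentiableAt (ho.mem_nhds ht)).hasFDerivAt
    exact h1.comp_hasDerivAt t ((hasDerivAt_const t x).prodMk (hasDerivAt_id t))
  refine ⟨?_, fun x t ht => (hd x t ht).differentiableAt.hasDerivAt⟩
  have hc := hC1.continuousOn_fderiv_of_isOpen ho le_rfl
  exact (hc.clm_apply continuousOn_const).congr fun p hp => (hd p.1 p.2 hp).deriv

/-- A function continuous on the half-space is integrable on bounded pieces of its slices. -/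
theorem integrableOn_ball_slice {E : Type*} [NormedAddCommGroup E] [NormedSpace ℝ E]
    [ProperSpace E] [MeasurableSpace E] [BorelSpace E] {μ : Measure E}
    [IsFiniteMeasureOnCompacts μ] {f : E × ℝ → ℝ}
    (hf : ContinuousOn f {p | 0 < p.2}) (R : ℝ) {t : ℝ} (ht : 0 < t) :
    IntegrableOn (fun x => f (x, t)) (ball 0 R) μ := by
  have h : Continuous fun x : E => f (x, t) :=
    hf.comp_continuous (by fun_prop) fun _ => ht
  exact (h.continuousOn.integrableOn_compact (isCompact_closedBall 0 R)).mono_set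
    ball_subset_closedBall

/-- Integrating a bound on `t ∂ₜw + u` in time bounds `w + u log t`. -/
theorem integral_abs_add_mul_log_le {E : Type*} [NormedAddCommGroup E] [NormedSpace ℝ E]
    [ProperSpace E] [MeasurableSpace E] [BorelSpace E] {μ : Measure E}
    [IsFiniteMeasureOnCompacts μ] [SFinite μ] {u : E → ℝ} {w : E × ℝ → ℝ}
    (hC1 : ContDiffOn ℝ 1 w {p : E × ℝ | 0 < p.2}) {R ε t t₀ : ℝ}
    (hu : IntegrableOn u (ball 0 R) μ) (ht : 0 < t) (htt : t ≤ t₀)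
    (hε : ∀ s ∈ Ioc t t₀,
      ∫ x in ball (0 : E) R, |s * deriv (fun τ : ℝ => w (x, τ)) s + u x| ∂μ ≤ ε) :
    ∫ x in ball (0 : E) R, |w (x, t) + u x * log t| ∂μ ≤
      (∫ x in ball (0 : E) R, |w (x, t₀) + u x * log t₀| ∂μ) + ε * (log t₀ - log t) := by
  obtain ⟨hDc, hD⟩ := continuousOn_deriv_snd hC1
  have ht₀ : 0 < t₀ := ht.trans_le htt
  have hslice : ∀ s, 0 < s → IntegrableOn (fun x => w (x, s) + u x * log s) (ball 0 R) μ :=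
    fun s hs => (integrableOn_ball_slice hC1.continuousOn R hs).add (hu.mul_const _)
  set D : E × ℝ → ℝ := fun p => deriv (fun τ : ℝ => w (p.1, τ)) p.2
  have hinvc : ContinuousOn (fun s : ℝ => s⁻¹) (Icc t t₀) :=
    continuousOn_inv₀.mono fun s hs => (ht.trans_le hs.1).ne'
  have hinv : IntegrableOn (fun s : ℝ => s⁻¹) (Ioc t t₀) :=
    hinvc.integrableOn_Icc.mono_set Ioc_subset_Icc_self
  have hg : Integrable (fun p : E × ℝ => D p + u p.1 * p.2⁻¹)
      ((μ.restrict (ball 0 R)).prod (volume.restrict (Ioc t t₀))) := by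
    refine Integrable.add ?_ (hu.mul_prod hinv)
    rw [Measure.prod_restrict]
    refine IntegrableOn.mono_set (t := closedBall (0 : E) R ×ˢ Icc t t₀) ?_
      (prod_mono ball_subset_closedBall Ioc_subset_Icc_self)
    exact (hDc.mono fun p hp => ht.trans_le hp.2.1).integrableOn_compact
      ((isCompact_closedBall 0 R).prod isCompact_Icc)
  have hftc : ∀ x, w (x, t) + u x * log t =
      (w (x, t₀) + u x * log t₀) - ∫ s in Ioc t t₀, (D (x, s) + u x * s⁻¹) := by
    intro x
    have hcont : ContinuousOn (fun s => D (x, s) + u x * s⁻¹) (Icc t t₀) := by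
      refine ContinuousOn.add ?_ (continuousOn_const.mul hinvc)
      exact hDc.comp (by fun_prop) fun s hs => ht.trans_le hs.1
    have := intervalIntegral.integral_eq_sub_of_hasDerivAt
      (f := fun s => w (x, s) + u x * log s) (f' := fun s => D (x, s) + u x * s⁻¹)
      (a := t) (b := t₀)
      (fun s hs => by
        rw [uIcc_of_le htt] at hs
        have hs0 : 0 < s := ht.trans_le hs.1
        exact (hD x s hs0).add ((hasDerivAt_log hs0.ne').const_mul (u x)))
      (hcont.intervalIntegrable_of_Icc htt)
    rw [intervalIntegral.integral_of_le htt] at this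
    rw [this]; ring
  have hJ : Integrable (fun x => ∫ s in Ioc t t₀, |D (x, s) + u x * s⁻¹|)
      (μ.restrict (ball 0 R)) := hg.abs.integral_prod_left
  calc ∫ x in ball (0 : E) R, |w (x, t) + u x * log t| ∂μ
      ≤ ∫ x in ball (0 : E) R, (|w (x, t₀) + u x * log t₀| +
          ∫ s in Ioc t t₀, |D (x, s) + u x * s⁻¹|) ∂μ := by
        refine integral_mono (hslice t ht).abs ((hslice t₀ ht₀).abs.add hJ) fun x => ?_
        simp only [hftc x]
        exact (abs_sub _ _).trans (by gcongr; exact abs_integral_le_integral_abs)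
    _ = (∫ x in ball (0 : E) R, |w (x, t₀) + u x * log t₀| ∂μ) +
          ∫ x in ball (0 : E) R, (∫ s in Ioc t t₀, |D (x, s) + u x * s⁻¹|) ∂μ :=
        integral_add (hslice t₀ ht₀).abs hJ
    _ = (∫ x in ball (0 : E) R, |w (x, t₀) + u x * log t₀| ∂μ) +
          ∫ s in Ioc t t₀, ∫ x in ball (0 : E) R, |D (x, s) + u x * s⁻¹| ∂μ := by
        rw [integral_integral_swap (f := fun x s => |D (x, s) + u x * s⁻¹|) hg.abs]
    _ ≤ (∫ x in ball (0 : E) R, |w (x, t₀) + u x * log t₀| ∂μ) +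
          ∫ s in Ioc t t₀, ε * s⁻¹ := by
        refine add_le_add le_rfl ?_
        refine setIntegral_mono_on hg.abs.integral_prod_right (hinv.const_mul ε)
          measurableSet_Ioc fun s hs => ?_
        have hs0 : 0 < s := ht.trans hs.1
        have heq : ∀ x, |D (x, s) + u x * s⁻¹| = |s * D (x, s) + u x| * s⁻¹ := by
          intro x
          rw [← abs_of_pos (inv_pos.2 hs0), ← abs_mul, abs_of_pos (inv_pos.2 hs0)]
          congr 1
          field_simp
        simp only [heq]
        rw [integral_mul_const]
        exact mul_le_mul_of_nonneg_right (hε s hs) (inv_pos.2 hs0).le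
    _ = _ := by
        rw [integral_const_mul, ← intervalIntegral.integral_of_le htt,
          integral_inv_of_pos ht ht₀, log_div ht₀.ne' ht.ne']

/-- if `u ∈ L^1_loc(ℝ^N)` and `w ∈ C¹(ℝ^N × (0,∞)) ∩ 𝒜𝒢(ℝ^N × (0,∞))`
satisfies `t ∂_t w(·,t) → −u` in `L^1_loc` as `t → 0⁺`, then also
`w(·,t)/ln t → −u` in `L^1_loc` as `t → 0⁺`. -/
theorem stmt3 (N : ℕ) (hN : 1 ≤ N) (u : EuclideanSpace ℝ (Fin N) → ℝ)
    (hu : MeasureTheory.LocallyIntegrable u volume)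
    (w : EuclideanSpace ℝ (Fin N) × ℝ → ℝ)
    (hC1 : ContDiffOn ℝ 1 w {p : EuclideanSpace ℝ (Fin N) × ℝ | 0 < p.2})
    (hloc : MeasureTheory.LocallyIntegrableOn w
      {p : EuclideanSpace ℝ (Fin N) × ℝ | 0 < p.2} volume)
    (hAG : ∃ C : ℝ, 0 < C ∧ ∃ σ : ℝ, 0 < σ ∧
      ∀ p : EuclideanSpace ℝ (Fin N) × ℝ, 0 < p.2 →
        (∫ q in {q : EuclideanSpace ℝ (Fin N) × ℝ |
            ‖q.1 - p.1‖ ^ 2 + (q.2 - p.2) ^ 2 < 1 ∧ 0 < q.2}, |w q|)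
          ≤ C * (1 + Real.sqrt (‖p.1‖ ^ 2 + p.2 ^ 2)) ^ σ)
    (hNeu : ∀ R : ℝ, 0 < R →
      Tendsto (fun t : ℝ =>
          ∫ x in Metric.ball (0 : EuclideanSpace ℝ (Fin N)) R,
            |t * deriv (fun τ : ℝ => w (x, τ)) t + u x|)
        (𝓝[>] (0 : ℝ)) (𝓝 0)) :
    ∀ R : ℝ, 0 < R →
      Tendsto (fun t : ℝ =>
          ∫ x in Metric.ball (0 : EuclideanSpace ℝ (Fin N)) R,
            |w (x, t) / Real.log t + u x|)
        (𝓝[>] (0 : ℝ)) (𝓝 0) := by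
  intro R hR
  have huB : IntegrableOn u (ball 0 R) :=
    (hu.integrableOn_isCompact (isCompact_closedBall 0 R)).mono_set ball_subset_closedBall
  refine Metric.tendsto_nhds.2 fun ε hε => ?_
  have hlt : ∀ᶠ s in 𝓝[>] (0 : ℝ), ∫ x in ball (0 : EuclideanSpace ℝ (Fin N)) R,
      |s * deriv (fun τ : ℝ => w (x, τ)) s + u x| < ε / 2 :=
    (hNeu R hR).eventually_lt_const (half_pos hε)
  obtain ⟨a, ha, hsub⟩ := mem_nhdsGT_iff_exists_Ioc_subset.1 hlt
  set t₀ : ℝ := min a 1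
  have ht₀ : 0 < t₀ := lt_min ha one_pos
  set C : ℝ := ∫ x in ball (0 : EuclideanSpace ℝ (Fin N)) R, |w (x, t₀) + u x * log t₀|
  have hlog : Tendsto (fun t : ℝ => -log t) (𝓝[>] 0) atTop :=
    tendsto_neg_atBot_atTop.comp tendsto_log_nhdsGT_zero
  have hC : ∀ᶠ t in 𝓝[>] (0 : ℝ), C / -log t < ε / 2 :=
    (hlog.const_div_atTop C).eventually_lt_const (half_pos hε)
  filter_upwards [hC, hlog.eventually_gt_atTop 0, Ioc_mem_nhdsGT ht₀] with t htC hl ht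
  have key := integral_abs_add_mul_log_le hC1 (t₀ := t₀) (ε := ε / 2) huB ht.1 ht.2
    fun s hs => (hsub ⟨ht.1.trans hs.1, hs.2.trans (min_le_left _ _)⟩ : _ < _).le
  have heq : ∀ x, |w (x, t) / log t + u x| = |w (x, t) + u x * log t| / -log t := by
    intro x
    have hl0 : log t < 0 := neg_pos.1 hl
    have hne : log t ≠ 0 := hl0.ne
    rw [← abs_of_neg hl0, ← abs_div]
    congr 1
    field_simp
  simp only [heq]
  rw [integral_div, dist_zero_right, norm_of_nonneg
    (div_nonneg (integral_nonneg fun x => abs_nonneg _) hl.le), div_lt_iff₀ hl]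
  rw [div_lt_iff₀ hl] at htC
  have hlog₀ : log t₀ ≤ 0 := log_nonpos ht₀.le (min_le_right _ _)
  nlinarith [mul_nonneg hε.le (neg_nonneg.2 hlog₀)]
end
end
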